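/- arXiv:2302.10052 — 3 statements merged into one kernel-verified Lean document; each statement's English description precedes it below -/
import Mathlib

section
/- Let G be a finite subgroup of GL_m(K). Then the algebra of invariants K[x_1,…,x_m]^G is finitely generated as a K-algebra; moreover it is generated by finitely many homogeneous polynomials f_1,…,f_p each of degree at most the order |G| of the group G. -/
open Matrix MvPolynomial

/-- The action of a matrix `g` on the polynomial algebra by linear substitution of the
variables: `x_j ↦ ∑ i, g i j • x_i`. -/
noncomputable def polyAct {K : Type*} [CommSemiring K] {m : ℕ}
    (g : Matrix (Fin m) (Fin m) K) :
    MvPolynomial (Fin m) K →ₐ[K] MvPolynomial (Fin m) K :=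
  aeval fun j => ∑ i, C (g i j) * X i

/-- The subalgebra of invariants of a subgroup `G` of `GL_m(K)`. -/
noncomputable def polyInvariants {K : Type*} [Field K] {m : ℕ}
    (G : Subgroup (GL (Fin m) K)) : Subalgebra K (MvPolynomial (Fin m) K) :=
  ⨅ g ∈ G, AlgHom.equalizer
    (polyAct ((g : GL (Fin m) K) : Matrix (Fin m) (Fin m) K)) (AlgHom.id K _)

section PowerSums

variable {K T σ : Type*} [Field K] [CharZero K] [CommRing T] [Algebra K T] [Fintype σ]

/-- Newton's identities: elementary symmetric functions lie in any subalgebra containing the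
power sums of at most the same degree. -/
theorem aeval_esymm_mem_of_sum_pow_mem (B : Subalgebra K T) (x : σ → T) (n : ℕ)
    (h : ∀ d ≤ n, ∑ i, x i ^ d ∈ B) : ∀ k ≤ n, aeval x (esymm σ K k) ∈ B := by
  intro k
  induction k using Nat.strong_induction_on with
  | _ k ih =>
  intro hk
  obtain rfl | hk0 := Nat.eq_zero_or_pos k
  · simp
  have hmul : ((k : K) • aeval x (esymm σ K k)) ∈ B := by
    have hN := congrArg (aeval x) (mul_esymm_eq_sum σ K k)
    simp only [map_mul, map_natCast, map_pow, map_neg, map_one, map_sum] at hN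
    rw [Algebra.smul_def, map_natCast, hN]
    refine B.mul_mem (B.pow_mem (B.neg_mem B.one_mem) _) (B.sum_mem fun a ha => ?_)
    rw [Finset.mem_filter, Finset.HasAntidiagonal.mem_antidiagonal] at ha
    refine B.mul_mem (B.mul_mem (B.pow_mem (B.neg_mem B.one_mem) _)
      (ih _ ha.2 (by omega))) ?_
    simpa [psum] using h a.2 (by omega)
  have hk' : (k : K) ≠ 0 := by exact_mod_cast hk0.ne'
  simpa [smul_smul, hk'] using B.smul_mem hmul (k : K)⁻¹

/-- In characteristic zero, all power sums of `n` elements lie in any subalgebra containing the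
power sums of degree at most `n`. -/
theorem sum_pow_mem_of_forall_le_card (B : Subalgebra K T) (x : σ → T)
    (h : ∀ d ≤ Fintype.card σ, ∑ i, x i ^ d ∈ B) (d : ℕ) : ∑ i, x i ^ d ∈ B := by
  obtain ⟨p, hp⟩ := esymmAlgHom_surjective (σ := σ) K le_rfl
    ⟨psum σ K d, psum_isSymmetric σ K d⟩
  have hp' := congrArg (aeval x) (congrArg Subtype.val hp)
  rw [esymmAlgHom_apply] at hp'
  have hd : ∑ i, x i ^ d = aeval x (psum σ K d) := by simp [psum]
  rw [hd, ← hp', ← AlgHom.comp_apply, comp_aeval]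
  let y : Fin (Fintype.card σ) → B := fun i =>
    ⟨aeval x (esymm σ K (i + 1)), aeval_esymm_mem_of_sum_pow_mem B x _ h _ (by omega)⟩
  have hy := Subalgebra.mvPolynomial_aeval_coe B y p
  exact hy ▸ (aeval y p).2

end PowerSums

section Invariants

variable {K : Type*} [Field K] {m : ℕ}

theorem polyAct_polyAct (g h : Matrix (Fin m) (Fin m) K) (f : MvPolynomial (Fin m) K) :
    polyAct g (polyAct h f) = polyAct (g * h) f := by
  rw [← AlgHom.comp_apply]
  congr 1
  ext j : 1
  simp only [polyAct, AlgHom.comp_apply, aeval_X, map_sum, map_mul, algHom_C, algebraMap_eq,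
    Matrix.mul_apply, Finset.mul_sum, Finset.sum_mul]
  rw [Finset.sum_comm]
  refine Finset.sum_congr rfl fun _ _ => Finset.sum_congr rfl fun _ _ => ?_
  ring

theorem MvPolynomial.IsHomogeneous.polyAct {f : MvPolynomial (Fin m) K} {n : ℕ}
    (hf : f.IsHomogeneous n) (g : Matrix (Fin m) (Fin m) K) : (polyAct g f).IsHomogeneous n := by
  simpa only [_root_.polyAct, one_mul] using hf.aeval _ fun j =>
    IsHomogeneous.sum Finset.univ _ 1 fun i _ => isHomogeneous_C_mul_X (g i j) i

theorem mem_polyInvariants {G : Subgroup (GL (Fin m) K)} {f : MvPolynomial (Fin m) K} :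
    f ∈ polyInvariants G ↔ ∀ g : G, polyAct (g : GL (Fin m) K).val f = f := by
  simp [polyInvariants, Algebra.mem_iInf, AlgHom.mem_equalizer]

variable (G : Subgroup (GL (Fin m) K)) [Fintype G]

/-- The sum of the images of a polynomial under the elements of a finite linear group. -/
noncomputable def polyTransfer : MvPolynomial (Fin m) K →ₗ[K] MvPolynomial (Fin m) K :=
  ∑ g : G, (polyAct (g : GL (Fin m) K).val).toLinearMap

theorem polyTransfer_apply (f : MvPolynomial (Fin m) K) :
    polyTransfer G f = ∑ g : G, polyAct (g : GL (Fin m) K).val f := by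
  simp [polyTransfer]

theorem polyTransfer_mem (f : MvPolynomial (Fin m) K) : polyTransfer G f ∈ polyInvariants G := by
  rw [mem_polyInvariants]
  intro h
  simp only [polyTransfer_apply, map_sum, polyAct_polyAct]
  exact Fintype.sum_equiv (Equiv.mulLeft h) _ _ fun g => by simp

variable {G} in
theorem polyTransfer_of_mem {f : MvPolynomial (Fin m) K} (hf : f ∈ polyInvariants G) :
    polyTransfer G f = (Fintype.card G : K) • f := by
  rw [mem_polyInvariants] at hf
  simp [polyTransfer_apply, hf, Nat.cast_smul_eq_nsmul]

/-- The transfers of monomials of degree `d` are, up to multinomial factors, the coefficients of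
the `d`-th power sum of the orbit of the generic linear form. -/
theorem coeff_sum_pow_generic_linear_form (a : Fin m →₀ ℕ) (d : ℕ) :
    coeff a (∑ g : G, (∑ i, polyAct (g : GL (Fin m) K).val (X i) • X i :
      MvPolynomial (Fin m) (MvPolynomial (Fin m) K)) ^ d) =
    if a.degree = d then (a.multinomial : K) • polyTransfer G (monomial a 1) else 0 := by
  have hdeg : (a.sum fun _ k => k) = a.degree := rfl
  simp only [coeff_sum, coeff_linearCombination_X_pow_of_fintype, hdeg]
  split_ifs
  · rw [polyTransfer_apply, Finset.smul_sum]
    refine Finset.sum_congr rfl fun g _ => ?_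
    rw [monomial_eq, C_1, one_mul, map_finsuppProd, Nat.cast_smul_eq_nsmul, nsmul_eq_mul]
    simp only [map_pow]
  · simp

/-- A subalgebra containing the transfers of the monomials of degree at most `|G|` contains the
transfers of all monomials. -/
theorem polyTransfer_monomial_mem [CharZero K] (A : Subalgebra K (MvPolynomial (Fin m) K))
    (hA : ∀ a : Fin m →₀ ℕ, a.degree ≤ Fintype.card G → polyTransfer G (monomial a 1) ∈ A)
    (a : Fin m →₀ ℕ) : polyTransfer G (monomial a 1) ∈ A := by
  let B : Subalgebra K (MvPolynomial (Fin m) (MvPolynomial (Fin m) K)) := (mapAlgHom A.val).range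
  have hB (p : MvPolynomial (Fin m) (MvPolynomial (Fin m) K)) :
      p ∈ B ↔ ∀ b, coeff b p ∈ A := by
    rw [← Subalgebra.mem_toSubmodule, range_mapAlgHom, mem_coeffsIn, Subalgebra.range_val]
    rfl
  have hsum := sum_pow_mem_of_forall_le_card B (fun g : G => ∑ i,
    polyAct (g : GL (Fin m) K).val (X i) • X i) (fun d hd => (hB _).2 fun b => by
      rw [coeff_sum_pow_generic_linear_form]
      split_ifs with hb
      · exact A.smul_mem (hA b (hb ▸ hd)) _
      · exact A.zero_mem) a.degree
  have ha := (hB _).1 hsum a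
  rw [coeff_sum_pow_generic_linear_form, if_pos rfl] at ha
  have hne : (a.multinomial : K) ≠ 0 := by
    exact_mod_cast (Nat.multinomial_pos _ _).ne'
  simpa [smul_smul, hne] using A.smul_mem ha (a.multinomial : K)⁻¹

end Invariants

/-- **Endlichkeitssatz (E. Noether).** The algebra of invariants of a finite linear group is
generated by finitely many homogeneous polynomials of degree at most `|G|`. -/
theorem noether_endlichkeitssatz {K : Type*} [Field K] [IsAlgClosed K] [CharZero K] {m : ℕ}
    (G : Subgroup (GL (Fin m) K)) [Fintype G] :
    ∃ s : Finset (MvPolynomial (Fin m) K),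
      (∀ f ∈ s, ∃ n : ℕ, n ≤ Fintype.card G ∧ f.IsHomogeneous n) ∧
      Algebra.adjoin K (s : Set (MvPolynomial (Fin m) K)) = polyInvariants G := by
  classical
  refine ⟨(Finsupp.finite_of_degree_le (σ := Fin m) (Fintype.card G)).toFinset.image
    fun a => polyTransfer G (monomial a 1), ?_, le_antisymm ?_ ?_⟩
  · simp only [Finset.mem_image, Set.Finite.mem_toFinset, Set.mem_ofPred_eq]
    rintro _ ⟨a, ha, rfl⟩
    refine ⟨a.degree, ha, ?_⟩
    rw [polyTransfer_apply]
    exact IsHomogeneous.sum _ _ _ fun g _ => (isHomogeneous_monomial _ rfl).polyAct _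
  · rw [Algebra.adjoin_le_iff]
    intro f hf
    simp only [Finset.coe_image, Set.mem_image] at hf
    obtain ⟨a, -, rfl⟩ := hf
    exact polyTransfer_mem G _
  · intro f hf
    set A := Algebra.adjoin K (_ : Set (MvPolynomial (Fin m) K))
    have hmon := polyTransfer_monomial_mem G A fun a ha => Algebra.subset_adjoin (by
      simp only [Finset.coe_image, Set.mem_image, Finset.mem_coe, Set.Finite.mem_toFinset]
      exact ⟨a, ha, rfl⟩)
    have htr : polyTransfer G f ∈ A := by
      rw [f.as_sum, map_sum]
      refine A.sum_mem fun a _ => ?_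
      rw [← mul_one (coeff a f), ← smul_eq_mul, ← smul_monomial, map_smul]
      exact A.smul_mem (hmon a) _
    rw [polyTransfer_of_mem hf] at htr
    have hne : (Fintype.card G : K) ≠ 0 := by exact_mod_cast Fintype.card_ne_zero
    simpa only [smul_smul, inv_mul_cancel₀ hne, one_smul] using
      A.smul_mem htr (Fintype.card G : K)⁻¹
end

section
/- For a finite subgroup G of GL_m(K), the algebra of invariants K[x_1,…,x_m]^G is isomorphic as a K-algebra to a polynomial algebra (in some number of variables) if and only if G is generated by pseudo-reflections. -/
open Matrix MvPolynomial

/-- A matrix is a pseudo-reflection if it is diagonalizable and `m - 1` of its eigenvalues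
(counted with multiplicity) are equal to `1`. -/
def IsPseudoReflection {K : Type*} [Field K] {m : ℕ}
    (g : Matrix (Fin m) (Fin m) K) : Prop :=
  ∃ (P : GL (Fin m) K) (d : Fin m → K) (i₀ : Fin m),
    g = (P : Matrix (Fin m) (Fin m) K) * Matrix.diagonal d *
        ((P⁻¹ : GL (Fin m) K) : Matrix (Fin m) (Fin m) K) ∧
    ∀ j : Fin m, j ≠ i₀ → d j = 1

namespace ShephardTodd

open Finset

variable {K : Type*} [Field K] {m : ℕ}

/-! ### Basic properties of the action -/

lemma polyAct_X (g : Matrix (Fin m) (Fin m) K) (j : Fin m) :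
    polyAct g (X j) = ∑ i, C (g i j) * X i := by
  simp [polyAct]

lemma polyAct_one : polyAct (1 : Matrix (Fin m) (Fin m) K) = AlgHom.id K _ := by
  ext j : 1
  simp [polyAct_X, Matrix.one_apply, Finset.sum_ite_eq']

lemma polyAct_mul (g h : Matrix (Fin m) (Fin m) K) :
    polyAct (g * h) = (polyAct g).comp (polyAct h) := by
  ext j : 1
  simp only [polyAct_X, AlgHom.comp_apply, map_sum, map_mul, Matrix.mul_apply, algHom_C,
    algebraMap_eq, Finset.sum_mul, Finset.mul_sum]
  rw [Finset.sum_comm]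
  refine sum_congr rfl fun i _ => sum_congr rfl fun k _ => ?_
  ring

/-- The action of `GL_m(K)` on polynomials, as a family of algebra endomorphisms. -/
noncomputable abbrev act (g : GL (Fin m) K) :
    MvPolynomial (Fin m) K →ₐ[K] MvPolynomial (Fin m) K :=
  polyAct (g : Matrix (Fin m) (Fin m) K)

lemma act_mul_apply (g h : GL (Fin m) K) (p : MvPolynomial (Fin m) K) :
    act (g * h) p = act g (act h p) := by
  simp [act, polyAct_mul]

lemma act_one_apply (p : MvPolynomial (Fin m) K) : act (1 : GL (Fin m) K) p = p := by
  simp [act, polyAct_one]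

lemma act_inv_act (g : GL (Fin m) K) (p : MvPolynomial (Fin m) K) : act g⁻¹ (act g p) = p := by
  rw [← act_mul_apply, inv_mul_cancel, act_one_apply]

lemma act_act_inv (g : GL (Fin m) K) (p : MvPolynomial (Fin m) K) : act g (act g⁻¹ p) = p := by
  rw [← act_mul_apply, mul_inv_cancel, act_one_apply]

lemma act_injective (g : GL (Fin m) K) : Function.Injective (act g) :=
  Function.LeftInverse.injective (act_inv_act g)

lemma isHomogeneous_sum_C_mul_X (c : Fin m → K) :
    (∑ i, C (c i) * X i : MvPolynomial (Fin m) K).IsHomogeneous 1 :=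
  IsHomogeneous.sum _ _ _ fun i _ => isHomogeneous_C_mul_X _ i

lemma coeff_sum_C_mul_X (c : Fin m → K) (k : Fin m) :
    coeff (Finsupp.single k 1) (∑ i, C (c i) * X i : MvPolynomial (Fin m) K) = c k := by
  simp [coeff_sum, coeff_X, Finsupp.single_left_inj]

lemma isHomogeneous_polyAct (g : Matrix (Fin m) (Fin m) K) {p : MvPolynomial (Fin m) K} {d : ℕ}
    (hp : p.IsHomogeneous d) : (polyAct g p).IsHomogeneous d := by
  have := hp.aeval (fun j => ∑ i, C (g i j) * X i) (n := 1)
    fun j => isHomogeneous_sum_C_mul_X fun i => g i j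
  simpa [polyAct] using this

lemma homogeneousComponent_polyAct (g : Matrix (Fin m) (Fin m) K) (p : MvPolynomial (Fin m) K)
    (d : ℕ) : homogeneousComponent d (polyAct g p) = polyAct g (homogeneousComponent d p) := by
  conv_lhs => rw [← sum_homogeneousComponent p, map_sum, map_sum]
  have h : ∀ i, homogeneousComponent d (polyAct g (homogeneousComponent i p)) =
      if i = d then polyAct g (homogeneousComponent i p) else 0 := fun i =>
    homogeneousComponent_of_mem (isHomogeneous_polyAct g (homogeneousComponent_isHomogeneous i p))
      |>.trans (by simp [eq_comm])
  simp only [h, Finset.sum_ite_eq', Finset.mem_range]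
  split_ifs with hd
  · rfl
  · rw [homogeneousComponent_eq_zero _ _ (by omega), map_zero]

lemma constantCoeff_polyAct (g : Matrix (Fin m) (Fin m) K) (p : MvPolynomial (Fin m) K) :
    constantCoeff (polyAct g p) = constantCoeff p := by
  have : (constantCoeff : MvPolynomial (Fin m) K →+* K).comp (polyAct g).toRingHom =
      constantCoeff := by
    ext j <;> simp [polyAct_X]
  exact congr($this p)

lemma totalDegree_polyAct_le (g : Matrix (Fin m) (Fin m) K) (p : MvPolynomial (Fin m) K) :
    (polyAct g p).totalDegree ≤ p.totalDegree := by
  conv_lhs => rw [← sum_homogeneousComponent p, map_sum]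
  refine totalDegree_finsetSum_le fun i hi => ?_
  exact (isHomogeneous_polyAct g (homogeneousComponent_isHomogeneous i p)).totalDegree_le.trans
    (by simpa [Nat.lt_succ_iff] using hi)

lemma mem_polyInvariants {G : Subgroup (GL (Fin m) K)} {p : MvPolynomial (Fin m) K} :
    p ∈ polyInvariants G ↔ ∀ g ∈ G, act g p = p := by
  simp [polyInvariants, Algebra.mem_iInf, AlgHom.mem_equalizer]

lemma homogeneousComponent_mem_polyInvariants {G : Subgroup (GL (Fin m) K)}
    {p : MvPolynomial (Fin m) K} (hp : p ∈ polyInvariants G) (d : ℕ) :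
    homogeneousComponent d p ∈ polyInvariants G := by
  rw [mem_polyInvariants] at hp ⊢
  intro g hg
  rw [act, ← homogeneousComponent_polyAct, ← act, hp g hg]

lemma C_mem_polyInvariants (G : Subgroup (GL (Fin m) K)) (c : K) : C c ∈ polyInvariants G :=
  (polyInvariants G).algebraMap_mem c

/-- The component of degree `d` of a product with one homogeneous factor. -/
lemma homogeneousComponent_mul_of_isHomogeneous (p : MvPolynomial (Fin m) K)
    {q : MvPolynomial (Fin m) K} {k : ℕ} (hq : q.IsHomogeneous k) (d : ℕ) :
    homogeneousComponent d (p * q) =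
      if k ≤ d then homogeneousComponent (d - k) p * q else 0 := by
  conv_lhs => rw [← sum_homogeneousComponent p, Finset.sum_mul, map_sum]
  have h : ∀ i, homogeneousComponent d (homogeneousComponent i p * q) =
      if i + k = d then homogeneousComponent i p * q else 0 := fun i =>
    (homogeneousComponent_of_mem ((homogeneousComponent_isHomogeneous i p).mul hq)).trans
      (by simp [eq_comm])
  simp only [h]
  split_ifs with hk
  · have hiff : ∀ i, i + k = d ↔ i = d - k := fun i => by omega
    simp only [hiff, Finset.sum_ite_eq', Finset.mem_range]
    split_ifs with hd
    · rfl
    · rw [homogeneousComponent_eq_zero _ _ (by omega), zero_mul]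
  · exact Finset.sum_eq_zero fun i _ => if_neg (by omega)

/-! ### The Reynolds operator -/

/-- The Reynolds operator, averaging over the group. -/
noncomputable def reynolds (G : Subgroup (GL (Fin m) K)) [Fintype G] :
    MvPolynomial (Fin m) K →ₗ[K] MvPolynomial (Fin m) K :=
  (Fintype.card G : K)⁻¹ • ∑ g : G, (act (g : GL (Fin m) K)).toLinearMap

section Reynolds

variable {G : Subgroup (GL (Fin m) K)} [Fintype G]

lemma reynolds_apply (p : MvPolynomial (Fin m) K) :
    reynolds G p = (Fintype.card G : K)⁻¹ • ∑ g : G, act (g : GL (Fin m) K) p := by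
  simp [reynolds]

lemma reynolds_mem (p : MvPolynomial (Fin m) K) : reynolds G p ∈ polyInvariants G := by
  rw [mem_polyInvariants]
  intro g hg
  have h : ∑ x : G, act g (act (x : GL (Fin m) K) p) = ∑ x : G, act (x : GL (Fin m) K) p :=
    Fintype.sum_equiv (Equiv.mulLeft (⟨g, hg⟩ : G)) _ _ fun x => (act_mul_apply g x p).symm
  rw [reynolds_apply, map_smul, map_sum, h]

lemma reynolds_mul {r : MvPolynomial (Fin m) K} (hr : r ∈ polyInvariants G)
    (p : MvPolynomial (Fin m) K) : reynolds G (r * p) = r * reynolds G p := by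
  rw [mem_polyInvariants] at hr
  simp only [reynolds_apply, map_mul, hr _ (SetLike.coe_mem _), ← Finset.mul_sum, mul_smul_comm]

variable [CharZero K]

lemma reynolds_of_mem {r : MvPolynomial (Fin m) K} (hr : r ∈ polyInvariants G) :
    reynolds G r = r := by
  rw [mem_polyInvariants] at hr
  simp [reynolds_apply, hr _ (SetLike.coe_mem _), ← Nat.cast_smul_eq_nsmul K, smul_smul]

lemma constantCoeff_reynolds (p : MvPolynomial (Fin m) K) :
    constantCoeff (reynolds G p) = constantCoeff p := by
  simp [reynolds_apply, constantCoeff_smul, constantCoeff_polyAct]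

lemma reynolds_sub_mem {p : MvPolynomial (Fin m) K} {I : Ideal (MvPolynomial (Fin m) K)}
    (h : ∀ g ∈ G, act g p - p ∈ I) : reynolds G p - p ∈ I := by
  have : reynolds G p - p = C (Fintype.card G : K)⁻¹ * ∑ g : G, (act (g : GL (Fin m) K) p - p) := by
    rw [reynolds_apply, Finset.sum_sub_distrib, mul_sub, ← smul_eq_C_mul, ← smul_eq_C_mul]
    simp [← Nat.cast_smul_eq_nsmul K, smul_smul]
  rw [this]
  exact I.mul_mem_left _ (I.sum_mem fun g _ => h g g.2)

end Reynolds

/-! ### Pseudo-reflections and divided differences -/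

/-- A matrix that differs from the identity by a matrix of rank at most one changes polynomials by
multiples of a fixed linear form. -/
lemma dvd_polyAct_sub (g : Matrix (Fin m) (Fin m) K) (L : MvPolynomial (Fin m) K)
    (hL : ∀ j, L ∣ polyAct g (X j) - X j) (p : MvPolynomial (Fin m) K) : L ∣ polyAct g p - p := by
  have h : (Ideal.Quotient.mkₐ K (Ideal.span {L})).comp (polyAct g) =
      Ideal.Quotient.mkₐ K (Ideal.span {L}) := by
    ext j : 1
    simp only [AlgHom.comp_apply, Ideal.Quotient.mkₐ_eq_mk]
    rw [Ideal.Quotient.eq, Ideal.mem_span_singleton]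
    exact hL j
  have h' := congr($h p)
  simp only [AlgHom.comp_apply, Ideal.Quotient.mkₐ_eq_mk] at h'
  rwa [Ideal.Quotient.eq, Ideal.mem_span_singleton] at h'

lemma exists_linearForm_of_isPseudoReflection {g : Matrix (Fin m) (Fin m) K}
    (hg : IsPseudoReflection g) :
    ∃ L : MvPolynomial (Fin m) K, L.IsHomogeneous 1 ∧ L ≠ 0 ∧ ∀ p, L ∣ polyAct g p - p := by
  obtain ⟨P, d, i₀, rfl, hd⟩ := hg
  refine ⟨∑ i, C ((P : Matrix (Fin m) (Fin m) K) i i₀) * X i, isHomogeneous_sum_C_mul_X _, ?_,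
    dvd_polyAct_sub _ _ fun j => ?_⟩
  · intro h0
    have hcol : ∀ i, (P : Matrix (Fin m) (Fin m) K) i i₀ = 0 := fun i => by
      rw [← coeff_sum_C_mul_X (fun i => (P : Matrix (Fin m) (Fin m) K) i i₀) i, h0, coeff_zero]
    have h1 : ((P⁻¹ : GL (Fin m) K) : Matrix (Fin m) (Fin m) K) * P = 1 := by
      rw [← Units.val_mul, inv_mul_cancel, Units.val_one]
    have h2 := congr($h1 i₀ i₀)
    simp [Matrix.mul_apply, hcol] at h2
  · have h1 : (P : Matrix (Fin m) (Fin m) K) * ((P⁻¹ : GL (Fin m) K) : Matrix (Fin m) (Fin m) K)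
        = 1 := by
      rw [← Units.val_mul, mul_inv_cancel, Units.val_one]
    have h2 : ∀ i, ((P : Matrix (Fin m) (Fin m) K) * Matrix.diagonal d *
        ((P⁻¹ : GL (Fin m) K) : Matrix (Fin m) (Fin m) K)) i j = (1 : Matrix (Fin m) (Fin m) K) i j
        + (P : Matrix (Fin m) (Fin m) K) i i₀ *
          ((d i₀ - 1) * ((P⁻¹ : GL (Fin m) K) : Matrix (Fin m) (Fin m) K) i₀ j) := by
      intro i
      rw [← h1, Matrix.mul_apply, Matrix.mul_apply, ← sub_eq_iff_eq_add', ← Finset.sum_sub_distrib,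
        Finset.sum_eq_single i₀]
      · rw [Matrix.mul_diagonal]; ring
      · intro k _ hk
        rw [Matrix.mul_diagonal, hd k hk]; ring
      · simp
    refine ⟨C ((d i₀ - 1) * ((P⁻¹ : GL (Fin m) K) : Matrix (Fin m) (Fin m) K) i₀ j), ?_⟩
    have h3 : ∑ i, C ((1 : Matrix (Fin m) (Fin m) K) i j) * X i = X j := by
      rw [← polyAct_X, polyAct_one, AlgHom.id_apply]
    simp only [polyAct_X, h2, C_add, add_mul, Finset.sum_add_distrib, h3, add_sub_cancel_left,
      Finset.sum_mul]
    refine Finset.sum_congr rfl fun i _ => ?_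
    rw [C_mul]; ring

/-- The divided difference of `p` along a pseudo-reflection has smaller degree than `p`. -/
lemma totalDegree_lt_of_polyAct_sub_eq {g : Matrix (Fin m) (Fin m) K}
    {L p q : MvPolynomial (Fin m) K} (hL : L.IsHomogeneous 1) (hL0 : L ≠ 0)
    (h : polyAct g p - p = L * q) (hq : q ≠ 0) : q.totalDegree < p.totalDegree := by
  have h1 : (L * q).totalDegree ≤ p.totalDegree :=
    h ▸ (totalDegree_sub _ _).trans (max_le (totalDegree_polyAct_le g p) le_rfl)
  rw [totalDegree_mul_of_isDomain hL0 hq, hL.totalDegree hL0] at h1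
  omega

/-! ### The Hilbert ideal -/

/-- Homogeneous invariants of positive degree. -/
def homogeneousInvariants (G : Subgroup (GL (Fin m) K)) : Set (MvPolynomial (Fin m) K) :=
  {p | p ∈ polyInvariants G ∧ ∃ d, 0 < d ∧ p.IsHomogeneous d}

/-- The ideal generated by the homogeneous invariants of positive degree. -/
noncomputable def hilbertIdeal (G : Subgroup (GL (Fin m) K)) : Ideal (MvPolynomial (Fin m) K) :=
  Ideal.span (homogeneousInvariants G)

lemma mem_hilbertIdeal {G : Subgroup (GL (Fin m) K)} {p : MvPolynomial (Fin m) K}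
    (hp : p ∈ polyInvariants G) (h0 : constantCoeff p = 0) : p ∈ hilbertIdeal G := by
  rw [← sum_homogeneousComponent p]
  refine Ideal.sum_mem _ fun i _ => ?_
  rcases Nat.eq_zero_or_pos i with rfl | hi
  · rw [homogeneousComponent_zero, ← constantCoeff_eq, h0, C_0]
    exact Ideal.zero_mem _
  · exact Ideal.subset_span ⟨homogeneousComponent_mem_polyInvariants hp i, i, hi,
      homogeneousComponent_isHomogeneous i p⟩

lemma act_mem_hilbertIdeal {G : Subgroup (GL (Fin m) K)} {g : GL (Fin m) K} (hg : g ∈ G)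
    {p : MvPolynomial (Fin m) K} (hp : p ∈ hilbertIdeal G) : act g p ∈ hilbertIdeal G := by
  refine Submodule.span_induction (p := fun p _ => act g p ∈ hilbertIdeal G) ?_ ?_ ?_ ?_ hp
  · intro x hx
    rw [mem_polyInvariants.1 hx.1 g hg]
    exact Ideal.subset_span hx
  · simp
  · intro x y _ _ hx hy
    rw [map_add]
    exact Ideal.add_mem _ hx hy
  · intro a x _ hx
    rw [smul_eq_mul, map_mul]
    exact Ideal.mul_mem_left _ _ hx

/-- If every pseudo-reflection in `G` fixes `p` modulo the Hilbert ideal and `G` is generated by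
them, then all of `G` does. -/
lemma act_sub_mem_hilbertIdeal {G : Subgroup (GL (Fin m) K)} {s : Set (GL (Fin m) K)}
    (hG : Subgroup.closure s = G) {p : MvPolynomial (Fin m) K}
    (hp : ∀ g ∈ s, act g p - p ∈ hilbertIdeal G) :
    ∀ g ∈ G, act g p - p ∈ hilbertIdeal G := by
  intro g hg
  rw [← hG] at hg
  induction hg using Subgroup.closure_induction with
  | mem x hx => exact hp x hx
  | one => simp [act_one_apply]
  | mul x y hx hy hpx hpy =>
    have : act (x * y) p - p = act x (act y p - p) + (act x p - p) := by
      rw [act_mul_apply, map_sub]; ring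
    rw [this]
    exact Ideal.add_mem _ (act_mem_hilbertIdeal (hG ▸ hx) hpy) hpx
  | inv x hx hpx =>
    have : act x⁻¹ p - p = -act x⁻¹ (act x p - p) := by
      rw [map_sub, act_inv_act]; ring
    rw [this]
    exact neg_mem (act_mem_hilbertIdeal (hG ▸ inv_mem hx) hpx)

/-- Chevalley's lemma: a linear relation `∑ hᵢ vᵢ = 0` over the invariants is, after applying a
functional `lam` on an ideal of the invariants, a relation modulo the Hilbert ideal. -/
lemma sum_C_mul_mem_hilbertIdeal [CharZero K] {G : Subgroup (GL (Fin m) K)} [Fintype G]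
    (hG : Subgroup.closure {g : GL (Fin m) K | g ∈ G ∧
      IsPseudoReflection (g : Matrix (Fin m) (Fin m) K)} = G)
    {ι : Type*} [Fintype ι] (h : ι → polyInvariants G) (lam : polyInvariants G →ₗ[K] K)
    (hlam : ∀ (r : polyInvariants G) (i : ι),
      lam (r * h i) = constantCoeff (r : MvPolynomial (Fin m) K) * lam (h i))
    (v : ι → MvPolynomial (Fin m) K) (hv : ∑ i, (h i : MvPolynomial (Fin m) K) * v i = 0) :
    ∑ i, C (lam (h i)) * v i ∈ hilbertIdeal G := by
  suffices H : ∀ (N : ℕ) (v : ι → MvPolynomial (Fin m) K),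
      (∑ i, (h i : MvPolynomial (Fin m) K) * v i = 0) →
      (∀ i, v i = 0 ∨ (v i).totalDegree < N) → ∑ i, C (lam (h i)) * v i ∈ hilbertIdeal G from
    H (∑ i, (v i).totalDegree + 1) v hv fun i => Or.inr <| Nat.lt_succ_of_le <|
      Finset.single_le_sum (f := fun i => (v i).totalDegree) (fun _ _ => Nat.zero_le _)
        (Finset.mem_univ i)
  intro N
  induction N with
  | zero =>
    intro v _ hdeg
    have hv0 : ∀ i, v i = 0 := fun i => (hdeg i).resolve_right (Nat.not_lt_zero _)
    simp [hv0]
  | succ N ih =>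
    intro v hv hdeg
    set w := ∑ i, C (lam (h i)) * v i with hw
    have hact : ∀ g ∈ G, act g w - w ∈ hilbertIdeal G := by
      refine act_sub_mem_hilbertIdeal hG ?_
      rintro g ⟨hgG, hg⟩
      obtain ⟨L, hL, hL0, hdvd⟩ := exists_linearForm_of_isPseudoReflection hg
      choose v' hv' using fun i => hdvd (v i)
      have hrel : ∑ i, (h i : MvPolynomial (Fin m) K) * v' i = 0 := by
        refine (mul_eq_zero.1 (?_ : L * _ = 0)).resolve_left hL0
        calc L * ∑ i, (h i : MvPolynomial (Fin m) K) * v' i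
            = ∑ i, (h i : MvPolynomial (Fin m) K) * (L * v' i) := by
              rw [Finset.mul_sum]; exact Finset.sum_congr rfl fun i _ => by ring
          _ = ∑ i, (act g ((h i : MvPolynomial (Fin m) K) * v i) -
                (h i : MvPolynomial (Fin m) K) * v i) := by
              refine Finset.sum_congr rfl fun i _ => ?_
              rw [← hv', map_mul, mem_polyInvariants.1 (h i).2 g hgG]; ring
          _ = 0 := by rw [Finset.sum_sub_distrib, ← map_sum, hv, map_zero, sub_zero]
      have hmem := ih v' hrel fun i => by
        by_cases h0 : v' i = 0
        · exact Or.inl h0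
        · have h1 := totalDegree_lt_of_polyAct_sub_eq hL hL0 (hv' i) h0
          rcases hdeg i with h2 | h2
          · simp [h2] at h1
          · exact Or.inr (by omega)
      have hdiff : act g w - w = L * ∑ i, C (lam (h i)) * v' i := by
        rw [hw, map_sum, ← Finset.sum_sub_distrib, Finset.mul_sum]
        refine Finset.sum_congr rfl fun i _ => ?_
        rw [map_mul, algHom_C, algebraMap_eq, ← mul_sub, hv' i]; ring
      rw [hdiff]
      exact Ideal.mul_mem_left _ _ hmem
    have hrey : reynolds G w ∈ hilbertIdeal G := by
      refine mem_hilbertIdeal (reynolds_mem w) ?_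
      have hrelR : ∑ i, (⟨reynolds G (v i), reynolds_mem (v i)⟩ : polyInvariants G) * h i = 0 := by
        apply Subtype.ext
        have := congr(reynolds G $hv)
        simp only [map_sum, reynolds_mul (h _).2, map_zero] at this
        simpa [mul_comm] using this
      have := congr(lam $hrelR)
      simp only [map_sum, hlam, constantCoeff_reynolds, map_zero] at this
      rw [constantCoeff_reynolds, hw]
      simpa [mul_comm] using this
    have := Ideal.sub_mem _ hrey (reynolds_sub_mem hact)
    rwa [sub_sub_cancel] at this

/-! ### Invariants of groups generated by pseudo-reflections -/

/-- The chain rule for derivations. -/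
lemma derivation_aeval {τ A M : Type*} [Fintype τ] [CommRing A] [Algebra K A] [AddCommGroup M]
    [Module K M] [Module A M] (D : Derivation K A M) (f : τ → A)
    (p : MvPolynomial τ K) : D (aeval f p) = ∑ i, aeval f (pderiv i p) • D (f i) := by
  classical
  induction p using MvPolynomial.induction_on with
  | C a => simp
  | add p q hp hq => simp [hp, hq, add_smul, Finset.sum_add_distrib]
  | mul_X p j hp =>
    simp [Derivation.leibniz, hp, add_smul, Finset.sum_add_distrib, Finset.smul_sum, smul_smul,
      pderiv_X, Pi.single_apply, apply_ite, Finset.sum_ite_eq, mul_comm]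
    rw [add_comm]

/-- The irrelevant ideal of polynomials without constant term. -/
noncomputable abbrev irrelevantIdeal (K : Type*) [Field K] (m : ℕ) :
    Ideal (MvPolynomial (Fin m) K) :=
  RingHom.ker constantCoeff

lemma exists_pderiv_ne_zero {τ : Type*} [CharZero K] {p : MvPolynomial τ K}
    (hp : p.totalDegree ≠ 0) : ∃ i, pderiv i p ≠ 0 ∧ (pderiv i p).totalDegree < p.totalDegree := by
  have hlt : ∀ i, (pderiv i p).totalDegree < p.totalDegree := fun i => by
    rw [totalDegree, Finset.sup_lt_iff (Nat.pos_of_ne_zero hp)]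
    intro d hd
    rw [mem_support_iff, coeff_pderiv] at hd
    have := le_totalDegree (mem_support_iff.2 (left_ne_zero_of_mul hd))
    rw [Finsupp.sum_add_index' (by simp) (by simp), Finsupp.sum_single_index rfl] at this
    omega
  have hvar : ∃ d ∈ p.support, d ≠ 0 := by
    by_contra! h
    exact hp ((totalDegree_eq_zero_iff _ p).2 fun d hd i => by simp [h d hd])
  obtain ⟨d, hd, hd0⟩ := hvar
  obtain ⟨i, hi⟩ := Finsupp.ne_iff.1 hd0
  refine ⟨i, fun h => ?_, hlt i⟩
  have h1 := congr(coeff (d - Finsupp.single i 1) $h)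
  rw [coeff_pderiv, coeff_zero, tsub_add_cancel_of_le
    (by simpa [Nat.one_le_iff_ne_zero] using hi)] at h1
  exact mul_ne_zero (mem_support_iff.1 hd) (Nat.cast_add_one_ne_zero _) h1

/-- Finitely many homogeneous invariants forming a basis of the Hilbert ideal modulo its product
with the irrelevant ideal. -/
lemma exists_minimal_generators (G : Subgroup (GL (Fin m) K)) :
    ∃ (n : ℕ) (f : Fin n → MvPolynomial (Fin m) K),
      (∀ b, f b ∈ homogeneousInvariants G) ∧
      (∀ c : Fin n → K, ∑ b, C (c b) * f b ∈ irrelevantIdeal K m * hilbertIdeal G → c = 0) ∧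
      ∀ p ∈ hilbertIdeal G, ∃ c : Fin n → K,
        p - ∑ b, C (c b) * f b ∈ irrelevantIdeal K m * hilbertIdeal G := by
  obtain ⟨t, ht, hspan⟩ := (Submodule.fg_span_iff_fg_span_finset_subset
    (homogeneousInvariants G)).1 (IsNoetherian.noetherian (hilbertIdeal G))
  change hilbertIdeal G = _ at hspan
  set N : Submodule K (MvPolynomial (Fin m) K) :=
    (irrelevantIdeal K m * hilbertIdeal G).restrictScalars K with hN
  obtain ⟨κ, a, ha, hsp, hli⟩ := exists_linearIndependent' K
    (fun x : t => N.mkQ (x : MvPolynomial (Fin m) K))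
  have : Finite κ := Finite.of_injective a ha
  obtain ⟨n, ⟨e⟩⟩ := Finite.exists_equiv_fin κ
  refine ⟨n, fun b => a (e.symm b), fun b => ht (a (e.symm b)).2, fun c hc => ?_, fun p hp => ?_⟩
  · have hli' := hli.comp e.symm e.symm.injective
    refine funext fun b => Fintype.linearIndependent_iff.1 hli' c ?_ b
    simp only [Function.comp_apply, ← map_smul, ← map_sum, smul_eq_C_mul]
    exact (Submodule.Quotient.mk_eq_zero N).2 hc
  · have hmem : N.mkQ p ∈ Submodule.span K (Set.range
        fun b => N.mkQ (a (e.symm b) : MvPolynomial (Fin m) K)) := by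
      have hrange : (Set.range fun b => N.mkQ (a (e.symm b) : MvPolynomial (Fin m) K)) =
          Set.range ((fun x : t => N.mkQ (x : MvPolynomial (Fin m) K)) ∘ a) :=
        e.symm.surjective.range_comp ((fun x : t => N.mkQ (x : MvPolynomial (Fin m) K)) ∘ a)
      rw [hrange, hsp]
      have hp' : p ∈ Submodule.span (MvPolynomial (Fin m) K) (t : Set (MvPolynomial (Fin m) K)) :=
        hspan ▸ hp
      induction hp' using Submodule.span_induction with
      | mem x hx => exact Submodule.subset_span ⟨⟨x, hx⟩, rfl⟩
      | zero => simp
      | add x y hx hy ihx ihy =>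
        rw [map_add]
        exact add_mem (ihx (hspan ▸ hx)) (ihy (hspan ▸ hy))
      | smul r x hx ihx =>
        have hxI : x ∈ hilbertIdeal G := hspan ▸ hx
        have h1 : N.mkQ (r • x) = constantCoeff r • N.mkQ x := by
          rw [← map_smul]
          refine (Submodule.Quotient.eq N).2 ?_
          rw [smul_eq_mul, smul_eq_C_mul, ← sub_mul]
          exact Ideal.mul_mem_mul (by simp [RingHom.mem_ker]) hxI
        rw [h1]
        exact Submodule.smul_mem _ _ (ihx hxI)
    obtain ⟨c, hc⟩ := (Submodule.mem_span_range_iff_exists_fun K).1 hmem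
    refine ⟨c, (Submodule.Quotient.eq N).1 ?_⟩
    simp only [← map_smul, ← map_sum, smul_eq_C_mul] at hc
    exact hc.symm

/-- Homogeneous invariants spanning the Hilbert ideal modulo its product with the irrelevant ideal
generate the algebra of invariants. -/
lemma adjoin_eq_polyInvariants [CharZero K] {G : Subgroup (GL (Fin m) K)} [Fintype G] {n : ℕ}
    {f : Fin n → MvPolynomial (Fin m) K} (hf : ∀ b, f b ∈ homogeneousInvariants G)
    (hspan : ∀ p ∈ hilbertIdeal G, ∃ c : Fin n → K,
      p - ∑ b, C (c b) * f b ∈ irrelevantIdeal K m * hilbertIdeal G) :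
    Algebra.adjoin K (Set.range f) = polyInvariants G := by
  refine le_antisymm (Algebra.adjoin_le ?_) fun p hp => ?_
  · rintro _ ⟨b, rfl⟩
    exact (hf b).1
  have hC : ∀ c : K, C c ∈ Algebra.adjoin K (Set.range f) := fun c =>
    (Algebra.adjoin K (Set.range f)).algebraMap_mem c
  suffices H : ∀ d, ∀ q ∈ polyInvariants G, q.IsHomogeneous d →
      q ∈ Algebra.adjoin K (Set.range f) by
    rw [← sum_homogeneousComponent p]
    exact sum_mem fun i _ => H i _ (homogeneousComponent_mem_polyInvariants hp i)
      (homogeneousComponent_isHomogeneous i p)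
  intro d
  induction d using Nat.strong_induction_on with
  | _ d ih =>
  intro q hq hqd
  rcases Nat.eq_zero_or_pos d with rfl | hd
  · rw [← totalDegree_zero_iff_isHomogeneous, totalDegree_eq_zero_iff_eq_C] at hqd
    rw [hqd]
    exact hC _
  obtain ⟨c, hc⟩ := hspan q (Ideal.subset_span ⟨hq, d, hd, hqd⟩)
  have key : ∀ i ∈ hilbertIdeal G, ∀ p ∈ irrelevantIdeal K m,
      homogeneousComponent d (reynolds G (p * i)) ∈ Algebra.adjoin K (Set.range f) := by
    intro i hi
    induction hi using Submodule.span_induction with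
    | mem x hx =>
      intro p hp
      obtain ⟨hxG, k, hk, hxk⟩ := hx
      rw [mul_comm, reynolds_mul hxG, mul_comm, homogeneousComponent_mul_of_isHomogeneous _ hxk]
      split_ifs with hkd
      · rcases hkd.eq_or_lt with rfl | hlt
        · rw [Nat.sub_self, homogeneousComponent_zero, ← constantCoeff_eq, constantCoeff_reynolds,
            RingHom.mem_ker.1 hp, C_0, zero_mul]
          exact zero_mem _
        · exact mul_mem (ih (d - k) (by omega) _
            (homogeneousComponent_mem_polyInvariants (reynolds_mem p) _)
            (homogeneousComponent_isHomogeneous _ _)) (ih k hlt _ hxG hxk)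
      · exact zero_mem _
    | zero => simp
    | add x y _ _ hx hy =>
      intro p hp
      rw [mul_add, map_add, map_add]
      exact add_mem (hx p hp) (hy p hp)
    | smul r x _ hx =>
      intro p hp
      rw [smul_eq_mul, ← mul_assoc]
      exact hx _ (Ideal.mul_mem_right _ _ hp)
  have key' : ∀ y ∈ irrelevantIdeal K m * hilbertIdeal G,
      homogeneousComponent d (reynolds G y) ∈ Algebra.adjoin K (Set.range f) := by
    intro y hy
    refine Submodule.mul_induction_on hy (fun p hp i hi => key i hi p hp) fun x y hx hy => ?_
    rw [map_add, map_add]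
    exact add_mem hx hy
  have h1 := key' _ hc
  have hsum : ∑ b, C (c b) * f b ∈ polyInvariants G :=
    sum_mem fun b _ => mul_mem (C_mem_polyInvariants G _) (hf b).1
  rw [reynolds_of_mem (sub_mem hq hsum), map_sub, homogeneousComponent_eq_self hqd, map_sum] at h1
  rw [← sub_add_cancel q (∑ b, homogeneousComponent d (C (c b) * f b))]
  refine add_mem h1 (sum_mem fun b _ => ?_)
  obtain ⟨k, -, hk⟩ := (hf b).2
  rw [homogeneousComponent_C_mul, homogeneousComponent_of_mem hk]
  refine mul_mem (hC _) ?_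
  split_ifs
  · exact Algebra.subset_adjoin ⟨b, rfl⟩
  · exact zero_mem _

/-- A nonzero finitely generated ideal of invariants carries a functional that factors through the
quotient by the invariants without constant term. -/
lemma exists_functional {G : Subgroup (GL (Fin m) K)} {ι : Type*} [Finite ι]
    (h : ι → polyInvariants G) (h0 : ∃ i, h i ≠ 0) :
    ∃ lam : polyInvariants G →ₗ[K] K, (∀ (r : polyInvariants G) (i : ι),
      lam (r * h i) = constantCoeff (r : MvPolynomial (Fin m) K) * lam (h i)) ∧
      ∃ i, lam (h i) ≠ 0 := by
  set ε : polyInvariants G →+* K := (constantCoeff : MvPolynomial (Fin m) K →+* K).comp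
    (polyInvariants G).val.toRingHom with hε
  set J : Ideal (polyInvariants G) := Ideal.span (Set.range h) with hJ
  have hmem : ∀ i, h i ∈ J := fun i => Ideal.subset_span ⟨i, rfl⟩
  have hne : ∃ i, h i ∉ RingHom.ker ε • J := by
    by_contra! hcon
    obtain ⟨r, hr, hr'⟩ := Submodule.exists_sub_one_mem_and_smul_eq_zero_of_fg_of_le_smul
      (RingHom.ker ε) J (Submodule.fg_span (Set.finite_range h))
      (Ideal.span_le.2 (Set.range_subset_iff.2 hcon))
    obtain ⟨i, hi⟩ := h0
    have hr0 : r = 0 := (mul_eq_zero.1 (hr' _ (hmem i))).resolve_right hi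
    rw [RingHom.mem_ker, hr0] at hr
    simp at hr
  obtain ⟨i, hi⟩ := hne
  obtain ⟨lam, hlam, hker⟩ := Submodule.exists_le_ker_of_notMem
    (p := (RingHom.ker ε • J).restrictScalars K) hi
  refine ⟨lam, fun r j => ?_, i, hlam⟩
  have h1 : r * h j - ε r • h j ∈ RingHom.ker ε • J := by
    have : r * h j - ε r • h j = (r - algebraMap K _ (ε r)) • h j := by
      rw [smul_eq_mul, sub_mul, Algebra.smul_def]
    rw [this]
    refine Submodule.smul_mem_smul ?_ (hmem j)
    rw [RingHom.mem_ker, map_sub, sub_eq_zero]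
    simp [hε]
  have h2 : lam (r * h j - ε r • h j) = 0 := hker h1
  rw [map_sub, map_smul, sub_eq_zero] at h2
  exact h2

lemma algebraicIndependent_of_minimal [CharZero K] {G : Subgroup (GL (Fin m) K)} [Fintype G]
    (hG : Subgroup.closure {g : GL (Fin m) K | g ∈ G ∧
      IsPseudoReflection (g : Matrix (Fin m) (Fin m) K)} = G) {n : ℕ}
    {f : Fin n → MvPolynomial (Fin m) K} (hf : ∀ b, f b ∈ homogeneousInvariants G)
    (hli : ∀ c : Fin n → K,
      ∑ b, C (c b) * f b ∈ irrelevantIdeal K m * hilbertIdeal G → c = 0) :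
    AlgebraicIndependent K f := by
  by_contra hdep
  have hex : ∃ N, ∃ p : MvPolynomial (Fin n) K, p ≠ 0 ∧ aeval f p = 0 ∧ p.totalDegree = N := by
    rw [algebraicIndependent_iff] at hdep
    push Not at hdep
    obtain ⟨p, hp, hp0⟩ := hdep
    exact ⟨_, p, hp0, hp, rfl⟩
  classical
  obtain ⟨p, hp0, hp, hdeg⟩ := Nat.find_spec hex
  have hmin : ∀ q : MvPolynomial (Fin n) K, q ≠ 0 → q.totalDegree < p.totalDegree →
      aeval f q ≠ 0 := fun q hq0 hlt hq =>
    Nat.find_min hex (hdeg ▸ hlt) ⟨q, hq0, hq, rfl⟩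
  have hpd : p.totalDegree ≠ 0 := fun h => by
    rw [totalDegree_eq_zero_iff_eq_C] at h
    rw [h, aeval_C, algebraMap_eq, C_eq_zero] at hp
    rw [hp, C_0] at h
    exact hp0 h
  obtain ⟨i, hi, hlt⟩ := exists_pderiv_ne_zero hpd
  have hmem : ∀ q : MvPolynomial (Fin n) K, aeval f q ∈ polyInvariants G := fun q => by
    refine Algebra.adjoin_le ?_ (aeval_range (R := K) f ▸ AlgHom.mem_range_self (aeval f) q)
    exact Set.range_subset_iff.2 fun b => (hf b).1
  obtain ⟨lam, hlam, j, hj⟩ := exists_functional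
    (fun b => (⟨aeval f (pderiv b p), hmem _⟩ : polyInvariants G))
    ⟨i, fun h => hmin _ hi hlt congr(($h : MvPolynomial (Fin m) K))⟩
  set c : Fin n → K := fun b => lam ⟨aeval f (pderiv b p), hmem _⟩ with hc
  have hrel : ∀ l, ∑ b, C (c b) * pderiv l (f b) ∈ hilbertIdeal G := fun l => by
    refine sum_C_mul_mem_hilbertIdeal hG _ lam hlam (fun b => pderiv l (f b)) ?_
    have := derivation_aeval (pderiv l) f p
    rw [hp, map_zero] at this
    exact this.symm
  choose d hd hfd using fun b => (hf b).2
  have hc0 := hli (fun b => c b * d b) <| by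
    have hsum : ∑ b, C (c b * d b) * f b = ∑ l, X l * ∑ b, C (c b) * pderiv l (f b) := by
      simp only [Finset.mul_sum]
      rw [Finset.sum_comm]
      refine Finset.sum_congr rfl fun b _ => ?_
      have := (hfd b).sum_X_mul_pderiv
      rw [C_mul, mul_assoc, map_natCast, ← nsmul_eq_mul, ← this, Finset.mul_sum]
      exact Finset.sum_congr rfl fun l _ => by ring
    rw [hsum]
    exact Ideal.sum_mem _ fun l _ => Ideal.mul_mem_mul (by simp [RingHom.mem_ker]) (hrel l)
  have := congr($hc0 j)
  simp only [Pi.zero_apply, mul_eq_zero, Nat.cast_eq_zero, (hd j).ne', or_false] at this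
  exact hj this

/-- Chevalley's theorem: the invariants of a finite group generated by pseudo-reflections form a
polynomial algebra. -/
theorem exists_algEquiv_of_closure_eq [CharZero K] (G : Subgroup (GL (Fin m) K)) [Fintype G]
    (hG : Subgroup.closure {g : GL (Fin m) K | g ∈ G ∧
      IsPseudoReflection (g : Matrix (Fin m) (Fin m) K)} = G) :
    ∃ n : ℕ, Nonempty ((polyInvariants G) ≃ₐ[K] MvPolynomial (Fin n) K) := by
  obtain ⟨n, f, hf, hli, hspan⟩ := exists_minimal_generators G
  exact ⟨n, ⟨(Subalgebra.equivOfEq _ _ (adjoin_eq_polyInvariants hf hspan)).symm.trans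
    (algebraicIndependent_of_minimal hG hf hli).aevalEquiv.symm⟩⟩

/-! ### Orbit polynomials -/

section OrbitPolynomial

variable (H : Subgroup (GL (Fin m) K)) [Finite H]

/-- The orbit of a polynomial under a finite group. -/
noncomputable def orbit (p : MvPolynomial (Fin m) K) : Finset (MvPolynomial (Fin m) K) :=
  (Set.finite_range fun h : H => act (h : GL (Fin m) K) p).toFinset

variable {H} in
lemma mem_orbit {p q : MvPolynomial (Fin m) K} : q ∈ orbit H p ↔ ∃ h ∈ H, act h p = q := by
  simp [orbit]

lemma self_mem_orbit (p : MvPolynomial (Fin m) K) : p ∈ orbit H p :=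
  mem_orbit.2 ⟨1, one_mem H, act_one_apply p⟩

/-- The monic polynomial whose roots are the elements of the orbit, each with multiplicity one. -/
noncomputable def orbitPolynomial (p : MvPolynomial (Fin m) K) :
    Polynomial (MvPolynomial (Fin m) K) :=
  ∏ a ∈ orbit H p, (Polynomial.X - Polynomial.C a)

lemma coeff_orbitPolynomial_mem (p : MvPolynomial (Fin m) K) (n : ℕ) :
    (orbitPolynomial H p).coeff n ∈ polyInvariants H := by
  rw [mem_polyInvariants]
  intro g hg
  have h : (orbitPolynomial H p).map (act g).toRingHom = orbitPolynomial H p := by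
    rw [orbitPolynomial, Polynomial.map_prod]
    simp only [Polynomial.map_sub, Polynomial.map_X, Polynomial.map_C]
    refine Finset.prod_nbij (act g) (fun a ha => ?_) (act_injective g).injOn (fun a ha => ?_)
      fun a _ => rfl
    · obtain ⟨h, hh, rfl⟩ := mem_orbit.1 ha
      exact mem_orbit.2 ⟨g * h, mul_mem hg hh, act_mul_apply g h p⟩
    · obtain ⟨h, hh, rfl⟩ := mem_orbit.1 ha
      exact ⟨act g⁻¹ (act h p), mem_orbit.2 ⟨g⁻¹ * h, mul_mem (inv_mem hg) hh,
        act_mul_apply g⁻¹ h p⟩, act_act_inv g _⟩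
  have := congr(($h).coeff n)
  rwa [Polynomial.coeff_map] at this

lemma eval_orbitPolynomial (p q : MvPolynomial (Fin m) K) :
    (orbitPolynomial H p).eval q = ∏ a ∈ orbit H p, (q - a) := by
  simp [orbitPolynomial, Polynomial.eval_prod]

lemma eval_orbitPolynomial_self (p : MvPolynomial (Fin m) K) :
    (orbitPolynomial H p).eval p = 0 := by
  rw [eval_orbitPolynomial]
  exact Finset.prod_eq_zero (self_mem_orbit H p) (sub_self p)

lemma eval_derivative_orbitPolynomial [DecidableEq (MvPolynomial (Fin m) K)]
    (p : MvPolynomial (Fin m) K) :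
    (orbitPolynomial H p).derivative.eval p = ∏ a ∈ (orbit H p).erase p, (p - a) := by
  rw [orbitPolynomial, ← Finset.mul_prod_erase _ _ (self_mem_orbit H p)]
  simp [Polynomial.derivative_mul, Polynomial.eval_prod]

lemma isAlgebraic_polyInvariants :
    Algebra.IsAlgebraic (polyInvariants H) (MvPolynomial (Fin m) K) := by
  suffices Algebra.IsIntegral (polyInvariants H) (MvPolynomial (Fin m) K) from inferInstance
  refine ⟨fun p => ?_⟩
  have hlift : orbitPolynomial H p ∈ Polynomial.lifts
      (algebraMap (polyInvariants H) (MvPolynomial (Fin m) K)) :=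
    (Polynomial.lifts_iff_coeff_lifts _).2 fun n => ⟨⟨_, coeff_orbitPolynomial_mem H p n⟩, rfl⟩
  obtain ⟨F, hF, -, hmonic⟩ := Polynomial.lifts_and_degree_eq_and_monic hlift
    (Polynomial.monic_prod_of_monic _ _ fun a _ => Polynomial.monic_X_sub_C a)
  exact ⟨F, hmonic, by rw [← Polynomial.eval_map, hF, eval_orbitPolynomial_self]⟩

/-- If the invariants form a polynomial algebra, the number of variables is `m`. -/
lemma eq_of_algEquiv {n : ℕ} (e : polyInvariants H ≃ₐ[K] MvPolynomial (Fin n) K) : n = m := by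
  have := isAlgebraic_polyInvariants H
  have h := trdeg_add_eq K (polyInvariants H) (A := MvPolynomial (Fin m) K)
  rw [trdeg_eq_zero (R := polyInvariants H), add_zero, e.trdeg_eq, MvPolynomial.trdeg_of_isDomain,
    MvPolynomial.trdeg_of_isDomain] at h
  simpa using h

end OrbitPolynomial

/-! ### Inertia -/

section Inertia

variable [CharZero K]

/-- If `g` acts trivially on the `H`-invariants modulo a prime `Q`, then it agrees with an element
of `H` modulo `Q`. -/
lemma exists_act_sub_act_mem (H : Subgroup (GL (Fin m) K)) [Finite H]
    (Q : Ideal (MvPolynomial (Fin m) K)) [Q.IsPrime] (g : GL (Fin m) K)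
    (hg : ∀ t ∈ polyInvariants H, act g t - t ∈ Q) : ∃ h ∈ H, ∀ p, act g p - act h p ∈ Q := by
  set V : H → Submodule K (MvPolynomial (Fin m) K) := fun h =>
    (Q.restrictScalars K).comap ((act g).toLinearMap - (act (h : GL (Fin m) K)).toLinearMap)
    with hV
  obtain ⟨h, hh⟩ := Subspace.exists_eq_top_of_iUnion_eq_univ (p := V) <| by
    refine Set.eq_univ_of_forall fun p => Set.mem_iUnion.2 ?_
    have h1 : (orbitPolynomial H p).map (Ideal.Quotient.mk Q) =
        ((orbitPolynomial H p).map (act g).toRingHom).map (Ideal.Quotient.mk Q) := by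
      ext n
      simp only [Polynomial.coeff_map]
      exact (Ideal.Quotient.eq.2 (hg _ (coeff_orbitPolynomial_mem H p n))).symm
    have h2 : Ideal.Quotient.mk Q ((orbitPolynomial H p).eval (act g p)) = 0 := by
      rw [← Polynomial.eval_map_apply, h1, Polynomial.eval_map_apply]
      have : ((orbitPolynomial H p).map (act g).toRingHom).eval (act g p) =
          act g ((orbitPolynomial H p).eval p) :=
        Polynomial.eval_map_apply (act g).toRingHom p
      rw [this, eval_orbitPolynomial_self, map_zero, map_zero]
    rw [Ideal.Quotient.eq_zero_iff_mem, eval_orbitPolynomial, Ideal.IsPrime.prod_mem_iff] at h2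
    obtain ⟨a, ha, haQ⟩ := h2
    obtain ⟨h, hh, rfl⟩ := mem_orbit.1 ha
    exact ⟨⟨h, hh⟩, haQ⟩
  refine ⟨h, h.2, fun p => ?_⟩
  have : p ∈ V h := hh ▸ Submodule.mem_top
  exact this

/-- If the Jacobian determinant of the `G`-invariants with respect to the `H`-invariants vanishes
under a homomorphism `π` to a domain, then some element of `G` outside `H` acts trivially on the
`H`-invariants modulo the kernel of `π`. -/
lemma exists_act_sub_mem_of_jacobian {G H : Subgroup (GL (Fin m) K)} [Finite G] {k : ℕ}
    (ι : MvPolynomial (Fin k) K →ₐ[K] MvPolynomial (Fin m) K)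
    (hι : Function.Injective ι) (hιH : ι.range = polyInvariants H)
    (f : Fin k → MvPolynomial (Fin k) K) (hf : (ι.comp (aeval f)).range = polyInvariants G)
    {B : Type*} [CommRing B] [IsDomain B] [Algebra K B] (π : MvPolynomial (Fin m) K →ₐ[K] B)
    (hdet : π (ι (Matrix.of fun i j => pderiv j (f i)).det) = 0) :
    ∃ g ∈ G, g ∉ H ∧ ∀ t ∈ polyInvariants H, π (act g t - t) = 0 := by
  classical
  let φ : MvPolynomial (Fin k) K →ₐ[K] B := π.comp ι
  let _ : Algebra (MvPolynomial (Fin k) K) B := φ.toRingHom.toAlgebra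
  have hsmul : ∀ (a : MvPolynomial (Fin k) K) (x : B), a • x = φ a * x :=
    fun a x => rfl
  have : IsScalarTower K (MvPolynomial (Fin k) K) B :=
    IsScalarTower.of_algebraMap_eq fun c => (φ.commutes c).symm
  obtain ⟨u, hu0, hu⟩ := Matrix.exists_mulVec_eq_zero_iff
    (M := φ.mapMatrix (Matrix.of fun i j => pderiv j (f i))).2 <| by
      rw [← AlgHom.map_det]
      exact hdet
  set D := mkDerivation K u with hD
  have hDf : ∀ i, D (f i) = 0 := fun i => by
    have h1 := derivation_aeval D X (f i)
    rw [aeval_X_left_apply] at h1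
    rw [h1]
    refine Eq.trans ?_ (congr_fun hu i)
    refine Finset.sum_congr rfl fun j _ => ?_
    rw [aeval_X_left_apply, hsmul, hD, mkDerivation_X]
    rfl
  have hDinv : ∀ a, ι a ∈ polyInvariants G → D a = 0 := fun a ha => by
    rw [← hf] at ha
    obtain ⟨b, hb⟩ := ha
    have hb' : aeval f b = a := hι hb
    rw [← hb', derivation_aeval]
    simp [hDf]
  have hlift : ∀ a, D a = 0 ∨ ∃ g ∈ G, g ∉ H ∧ π (act g (ι a) - ι a) = 0 := fun a => by
    have hmem : ι a ∈ polyInvariants H := hιH ▸ AlgHom.mem_range_self ι a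
    have hlifts : orbitPolynomial G (ι a) ∈ Polynomial.lifts ι.toRingHom :=
      (Polynomial.lifts_iff_coeff_lifts _).2 fun n => by
        have h1 := coeff_orbitPolynomial_mem G (ι a) n
        rw [← hf] at h1
        obtain ⟨b, hb⟩ := h1
        exact ⟨aeval f b, hb⟩
    obtain ⟨F, hF⟩ := (Polynomial.mem_lifts _).1 hlifts
    have hcoeff : ∀ n, D (F.coeff n) = 0 := fun n => hDinv _ <| by
      have : ι (F.coeff n) = (orbitPolynomial G (ι a)).coeff n := by
        rw [← hF, Polynomial.coeff_map]; rfl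
      rw [this]
      exact coeff_orbitPolynomial_mem G (ι a) n
    have heval : F.eval a = 0 := hι <| by
      have := Polynomial.eval_map_apply (p := F) ι.toRingHom a
      rw [hF] at this
      exact this.symm.trans ((eval_orbitPolynomial_self G (ι a)).trans (map_zero ι).symm)
    have hder : D (F.eval a) = F.derivative.eval a • D a := by
      rw [Polynomial.eval_eq_sum, Polynomial.derivative_eval, Polynomial.sum, Polynomial.sum,
        map_sum, Finset.sum_smul]
      refine Finset.sum_congr rfl fun n _ => ?_
      rw [Derivation.leibniz, hcoeff, smul_zero, add_zero, Derivation.leibniz_pow,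
        ← Nat.cast_smul_eq_nsmul (MvPolynomial (Fin k) K), smul_smul, smul_smul]
    rw [heval, map_zero, hsmul, eq_comm, mul_eq_zero] at hder
    rcases hder with h1 | h1
    · right
      have h2 : ι (F.derivative.eval a) = ∏ b ∈ (orbit G (ι a)).erase (ι a), (ι a - b) := by
        rw [← eval_derivative_orbitPolynomial, ← hF, Polynomial.derivative_map]
        exact (Polynomial.eval_map_apply ι.toRingHom a).symm
      have h3 : π (ι (F.derivative.eval a)) = 0 := h1
      rw [h2, map_prod, Finset.prod_eq_zero_iff] at h3
      obtain ⟨b, hb, hbQ⟩ := h3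
      obtain ⟨hne, hb⟩ := Finset.mem_erase.1 hb
      obtain ⟨g, hg, rfl⟩ := mem_orbit.1 hb
      exact ⟨g, hg, fun hgH => hne (mem_polyInvariants.1 hmem g hgH), by
        rw [← neg_sub, map_neg, hbQ, neg_zero]⟩
    · exact Or.inl h1
  set V : Option {g : G // (g : GL (Fin m) K) ∉ H} → Submodule K (MvPolynomial (Fin k) K) :=
    fun o => o.elim (LinearMap.ker D.toLinearMap) fun g =>
      LinearMap.ker (π.toLinearMap ∘ₗ
        (((act (g : GL (Fin m) K)).comp ι).toLinearMap - ι.toLinearMap))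
    with hV
  obtain ⟨o, ho⟩ := Subspace.exists_eq_top_of_iUnion_eq_univ (p := V) <| by
    refine Set.eq_univ_of_forall fun a => Set.mem_iUnion.2 ?_
    rcases hlift a with h | ⟨g, hg, hgH, h⟩
    · exact ⟨none, h⟩
    · exact ⟨some ⟨⟨g, hg⟩, hgH⟩, h⟩
  cases o with
  | none =>
    refine absurd (_root_.funext fun j => ?_) hu0
    have : X j ∈ V none := ho ▸ Submodule.mem_top
    have h1 : D (X j) = 0 := this
    rwa [hD, mkDerivation_X] at h1
  | some g =>
    refine ⟨g, g.1.2, g.2, fun t ht => ?_⟩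
    rw [← hιH] at ht
    obtain ⟨a, rfl⟩ := ht
    have : a ∈ V (some g) := ho ▸ Submodule.mem_top
    exact this

end Inertia

/-! ### Unit Jacobian determinants -/

section Jacobian

variable {k : ℕ}

/-- First order Taylor expansion of a polynomial at a `K`-point. -/
lemma sub_taylor_mem_ker_sq (ε : MvPolynomial (Fin k) K →ₐ[K] K) (p : MvPolynomial (Fin k) K) :
    p - C (ε p) - ∑ j, C (ε (pderiv j p)) * (X j - C (ε (X j))) ∈ RingHom.ker ε ^ 2 := by
  have hker : ∀ q, q - C (ε q) ∈ RingHom.ker ε := fun q => by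
    rw [RingHom.mem_ker, map_sub, algHom_C, Algebra.algebraMap_self_apply, sub_self]
  induction p using MvPolynomial.induction_on with
  | C a => simp
  | add p q hp hq =>
    convert add_mem hp hq using 1
    simp only [map_add, add_mul, Finset.sum_add_distrib]
    ring
  | mul_X p i hp =>
    have hprod : (p - C (ε p)) * (X i - C (ε (X i))) ∈ RingHom.ker ε ^ 2 := by
      rw [pow_two]
      exact Ideal.mul_mem_mul (hker p) (hker _)
    convert add_mem hprod (Ideal.mul_mem_left _ (C (ε (X i))) hp) using 1
    have hsum : ∑ j, C (ε (pderiv j (p * X i))) * (X j - C (ε (X j))) =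
        C (ε p) * (X i - C (ε (X i))) +
          C (ε (X i)) * ∑ j, C (ε (pderiv j p)) * (X j - C (ε (X j))) := by
      have hi : C (ε p) * (X i - C (ε (X i))) =
          ∑ j, if j = i then C (ε p) * (X j - C (ε (X j))) else 0 := by simp
      rw [hi, Finset.mul_sum, ← Finset.sum_add_distrib]
      refine Finset.sum_congr rfl fun j _ => ?_
      rw [Derivation.leibniz, pderiv_X]
      by_cases hj : j = i
      · subst hj
        simp only [Pi.single_eq_same, smul_eq_mul, map_add, map_mul, mul_one, if_true]
        ring
      · simp only [Pi.single_eq_of_ne' hj, smul_eq_mul, map_mul, mul_zero, zero_add,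
          if_neg hj, mul_assoc]
    rw [hsum, map_mul, map_mul]
    ring

/-- If the Jacobian determinant of `f` is a unit, every polynomial agrees with an element of the
algebra generated by `f` to first order at a given `K`-point. -/
lemma exists_sub_aeval_mem_ker_sq (ε : MvPolynomial (Fin k) K →ₐ[K] K)
    (f : Fin k → MvPolynomial (Fin k) K)
    (hdet : IsUnit (Matrix.of fun i j => pderiv j (f i)).det) (p : MvPolynomial (Fin k) K) :
    ∃ b : MvPolynomial (Fin k) K, p - aeval f b ∈ RingHom.ker ε ^ 2 := by
  set N : Matrix (Fin k) (Fin k) K := ε.mapMatrix (Matrix.of fun i j => pderiv j (f i)) with hN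
  have hNdet : IsUnit N.det := by
    rw [hN, ← AlgHom.map_det]
    exact hdet.map ε
  set c : Fin k → K := (fun j => ε (pderiv j p)) ᵥ* N⁻¹ with hc
  have hcN : ∀ j, ∑ i, c i * ε (pderiv j (f i)) = ε (pderiv j p) := fun j => by
    have : c ᵥ* N = fun j => ε (pderiv j p) := by
      rw [hc, Matrix.vecMul_vecMul, Matrix.nonsing_inv_mul _ hNdet, Matrix.vecMul_one]
    exact congr_fun this j
  refine ⟨C (ε p) + ∑ i, C (c i) * (X i - C (ε (f i))), ?_⟩
  set q := p - aeval f (C (ε p) + ∑ i, C (c i) * (X i - C (ε (f i)))) with hq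
  have hq' : q = p - C (ε p) - ∑ i, C (c i) * (f i - C (ε (f i))) := by
    simp [hq, sub_sub, algebraMap_eq]
  have h0 : ε q = 0 := by simp [hq']
  have h1 : ∀ j, ε (pderiv j q) = 0 := fun j => by
    simp [hq', Derivation.leibniz, hcN]
  simpa [h0, h1] using sub_taylor_mem_ker_sq ε q

/-- If the Jacobian determinant of the `G`-invariants with respect to the `H`-invariants is a
unit, then every `H`-invariant is a `G`-invariant. -/
lemma polyInvariants_le_of_isUnit_jacobian {G H : Subgroup (GL (Fin m) K)}
    (ι : MvPolynomial (Fin k) K →ₐ[K] MvPolynomial (Fin m) K)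
    (hιH : ι.range = polyInvariants H)
    (f : Fin k → MvPolynomial (Fin k) K) (hf : (ι.comp (aeval f)).range = polyInvariants G)
    (hdet : IsUnit (Matrix.of fun i j => pderiv j (f i)).det) :
    polyInvariants H ≤ polyInvariants G := by
  set ε : MvPolynomial (Fin k) K →ₐ[K] K :=
    (aeval (0 : Fin m → K) : MvPolynomial (Fin m) K →ₐ[K] K).comp ι with hε
  have hker : ∀ y ∈ RingHom.ker ε, homogeneousComponent 0 (ι y) = 0 := fun y hy => by
    rw [RingHom.mem_ker, hε, AlgHom.comp_apply, aeval_zero, Algebra.algebraMap_self_apply,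
      constantCoeff_eq] at hy
    rw [homogeneousComponent_zero, hy, map_zero]
  have hmem : ∀ y, ι y ∈ polyInvariants H := fun y => hιH ▸ AlgHom.mem_range_self ι y
  have key : ∀ d, ∀ t ∈ polyInvariants H, homogeneousComponent d t ∈ polyInvariants G := by
    intro d
    induction d using Nat.strong_induction_on with
    | _ d ih =>
      have hsq : ∀ y ∈ RingHom.ker ε ^ 2, homogeneousComponent d (ι y) ∈ polyInvariants G := by
        intro y hy
        rw [pow_two] at hy
        induction hy using Submodule.mul_induction_on' with
        | mem_mul_mem y₁ hy₁ y₂ hy₂ =>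
          rw [map_mul]
          rw [← sum_homogeneousComponent (ι y₂), Finset.mul_sum, map_sum]
          refine sum_mem fun l _ => ?_
          rw [homogeneousComponent_mul_of_isHomogeneous _ (homogeneousComponent_isHomogeneous l _)]
          split_ifs with hl
          · rcases Nat.eq_zero_or_pos l with rfl | hl0
            · rw [hker y₂ hy₂, mul_zero]
              exact zero_mem _
            rcases hl.eq_or_lt with rfl | hld
            · rw [Nat.sub_self, hker y₁ hy₁, zero_mul]
              exact zero_mem _
            exact mul_mem (ih _ (by omega) _ (hmem y₁)) (ih _ hld _ (hmem y₂))
          · exact zero_mem _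
        | add x _ y _ hx hy =>
          rw [map_add, map_add]
          exact add_mem hx hy
      intro t ht
      rw [← hιH] at ht
      obtain ⟨a, rfl⟩ := ht
      obtain ⟨b, hb⟩ := exists_sub_aeval_mem_ker_sq ε f hdet a
      have hbG : ι (aeval f b) ∈ polyInvariants G :=
        hf ▸ AlgHom.mem_range_self (ι.comp (aeval f)) b
      have := add_mem (hsq _ hb) (homogeneousComponent_mem_polyInvariants hbG d)
      rwa [← map_add, ← map_add, sub_add_cancel] at this
  intro t ht
  rw [← sum_homogeneousComponent t]
  exact sum_mem fun d _ => key d t ht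

end Jacobian

/-! ### Recognizing pseudo-reflections -/

/-- A rank one perturbation of the identity is a pseudo-reflection if it is not a transvection. -/
lemma isPseudoReflection_one_add_vecMulVec {u v : Fin m → K} {j₀ : Fin m} (hv : v j₀ = 1)
    (huv : v ⬝ᵥ u ≠ 0) : IsPseudoReflection (1 + vecMulVec u v) := by
  set e : Fin m → K := Pi.single j₀ 1 with he
  have hve : v ⬝ᵥ e = 1 := by simp [he, hv]
  have hee : e ⬝ᵥ e = 1 := by simp [he]
  set P : Matrix (Fin m) (Fin m) K := 1 - vecMulVec e v + vecMulVec u e with hP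
  have hPmul : ∀ w, P *ᵥ w = w - (v ⬝ᵥ w) • e + (e ⬝ᵥ w) • u := fun w => by
    rw [hP, Matrix.add_mulVec, Matrix.sub_mulVec, Matrix.one_mulVec, vecMulVec_mulVec,
      vecMulVec_mulVec]
    simp
  have hunit : IsUnit P := by
    rw [← Matrix.mulVec_injective_iff_isUnit]
    refine (injective_iff_map_eq_zero (Matrix.mulVecLin P)).2 fun w hw => ?_
    rw [Matrix.mulVecLin_apply, hPmul] at hw
    have h1 : e ⬝ᵥ w = 0 := by
      have := congr(v ⬝ᵥ $hw)
      simpa [dotProduct_add, dotProduct_sub, hve, huv] using this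
    have h2 : v ⬝ᵥ w = 0 := by
      have := congr(e ⬝ᵥ $hw)
      simpa [dotProduct_add, dotProduct_sub, hee, h1] using this
    simpa [h1, h2] using hw
  obtain ⟨P', hP'⟩ := hunit
  have hdiag : Matrix.diagonal (1 + (v ⬝ᵥ u) • e) = 1 + (v ⬝ᵥ u) • vecMulVec e e := by
    ext i j
    by_cases hij : i = j
    · subst hij
      by_cases hi : i = j₀ <;> simp [he, vecMulVec_apply, hi]
    · by_cases hi : i = j₀
      · subst hi
        simp [he, vecMulVec_apply, hij, Ne.symm hij]
      · simp [he, vecMulVec_apply, Pi.single_apply, hij, hi]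
  refine ⟨P', 1 + (v ⬝ᵥ u) • e, j₀, ?_, fun j hj => by simp [he, hj]⟩
  have hcomm : (1 + vecMulVec u v) * P = P * Matrix.diagonal (1 + (v ⬝ᵥ u) • e) := by
    have hPe : P *ᵥ e = u := by rw [hPmul, hve, hee]; simp
    rw [hdiag, mul_add P, mul_one P, mul_smul_comm, mul_vecMulVec, hPe, add_mul, one_mul, hP]
    simp only [mul_add, mul_sub, mul_one, vecMulVec_mul_vecMulVec, hve, one_smul, sub_self,
      zero_add, vecMulVec_smul]
  rw [hP', ← hcomm, ← hP', mul_assoc, ← Units.val_mul, mul_inv_cancel, Units.val_one, mul_one]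

/-- If a non-unit `L` divides a linear form and a nonzero linear form, the former is a scalar
multiple of the latter. -/
lemma exists_eq_C_mul_of_dvd {L p q : MvPolynomial (Fin m) K} (hL : ¬ IsUnit L)
    (hp : p.IsHomogeneous 1) (hq : q.IsHomogeneous 1) (hq0 : q ≠ 0) (hLp : L ∣ p) (hLq : L ∣ q) :
    ∃ c, p = C c * q := by
  have hconst : ∀ r : MvPolynomial (Fin m) K, r.IsHomogeneous 1 → r ≠ 0 → L ∣ r →
      ∃ c, c ≠ 0 ∧ r = C c * L := by
    rintro r hr hr0 ⟨s, rfl⟩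
    have hL0 : L ≠ 0 := left_ne_zero_of_mul hr0
    have hs0 : s ≠ 0 := right_ne_zero_of_mul hr0
    have hdeg := hr.totalDegree hr0
    rw [totalDegree_mul_of_isDomain hL0 hs0] at hdeg
    have hLdeg : L.totalDegree ≠ 0 := fun h => hL <| by
      rw [totalDegree_eq_zero_iff_eq_C] at h
      have hc : coeff 0 L ≠ 0 := fun h0 => hL0 (by rw [h, h0, C_0])
      rw [h]
      exact hc.isUnit.map C
    have hs : s.totalDegree = 0 := by omega
    rw [totalDegree_eq_zero_iff_eq_C] at hs
    refine ⟨coeff 0 s, fun h0 => hs0 (by rw [hs, h0, C_0]), ?_⟩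
    rw [← hs, mul_comm]
  by_cases hp0 : p = 0
  · exact ⟨0, by simp [hp0]⟩
  obtain ⟨a, -, ha⟩ := hconst p hp hp0 hLp
  obtain ⟨b, hb0, hb⟩ := hconst q hq hq0 hLq
  refine ⟨a * b⁻¹, ?_⟩
  rw [ha, hb, ← mul_assoc, ← C_mul, mul_assoc, inv_mul_cancel₀ hb0, mul_one]

/-- A matrix of finite order acting trivially modulo a non-unit polynomial is the identity or
a pseudo-reflection. -/
lemma eq_one_or_isPseudoReflection [CharZero K] {r : GL (Fin m) K} (hr : IsOfFinOrder r)
    {L : MvPolynomial (Fin m) K} (hL : ¬ IsUnit L) (hrL : ∀ j, L ∣ act r (X j) - X j) :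
    r = 1 ∨ IsPseudoReflection (r : Matrix (Fin m) (Fin m) K) := by
  set A : Matrix (Fin m) (Fin m) K := r - 1 with hA
  have hrA : (r : Matrix (Fin m) (Fin m) K) = 1 + A := by rw [hA, add_sub_cancel]
  have hact : ∀ j, act r (X j) - X j = ∑ i, C (A i j) * X i := fun j => by
    have h1 := polyAct_X (1 : Matrix (Fin m) (Fin m) K) j
    rw [polyAct_one, AlgHom.id_apply] at h1
    rw [polyAct_X, h1, ← Finset.sum_sub_distrib]
    simp [hA, sub_mul]
  by_cases hA0 : A = 0
  · left
    ext1
    rw [hrA, hA0, add_zero, Units.val_one]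
  right
  obtain ⟨i₁, j₀, hij⟩ : ∃ i j, A i j ≠ 0 := by
    by_contra! h
    exact hA0 (Matrix.ext h)
  have hne : (∑ i, C (A i j₀) * X i : MvPolynomial (Fin m) K) ≠ 0 := fun h => hij <| by
    rw [← coeff_sum_C_mul_X (fun i => A i j₀) i₁, h, coeff_zero]
  simp only [hact] at hrL
  choose v hv using fun j => exists_eq_C_mul_of_dvd hL
    (isHomogeneous_sum_C_mul_X fun i => A i j) (isHomogeneous_sum_C_mul_X fun i => A i j₀) hne
    (hrL j) (hrL j₀)
  have hAv : ∀ i j, A i j = A i j₀ * v j := fun i j => by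
    rw [← coeff_sum_C_mul_X (fun i => A i j) i, hv j, coeff_C_mul, coeff_sum_C_mul_X, mul_comm]
  set u : Fin m → K := fun i => A i j₀ with hu
  have hAuv : A = vecMulVec u v := Matrix.ext hAv
  have hvj : v j₀ = 1 := mul_left_cancel₀ hij (by rw [← hAv, mul_one])
  rw [hrA, hAuv]
  refine isPseudoReflection_one_add_vecMulVec hvj fun huv => hA0 ?_
  have hsq : A * A = 0 := by
    rw [hAuv, vecMulVec_mul_vecMulVec, huv, zero_smul, vecMulVec_zero]
  have hpow : ∀ n : ℕ, (1 + A) ^ n = 1 + n • A := fun n => by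
    induction n with
    | zero => simp
    | succ n ih =>
      rw [pow_succ, ih, mul_add, mul_one, add_mul, one_mul, smul_mul_assoc, hsq, smul_zero,
        add_zero, succ_nsmul, add_assoc]
  obtain ⟨n, hn, hrn⟩ := isOfFinOrder_iff_pow_eq_one.1 hr
  have h1 := hpow n
  rw [← hrA, ← Units.val_pow_eq_pow_val, hrn, Units.val_one, left_eq_add] at h1
  rw [← Nat.cast_smul_eq_nsmul K] at h1
  exact (smul_eq_zero.1 h1).resolve_left (Nat.cast_ne_zero.2 hn.ne')

/-! ### Polynomial invariants force generation by pseudo-reflections -/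

section Subalgebra

variable {A B : Type*} [CommRing A] [Algebra K A] [CommRing B] [Algebra K B]

lemma range_val_comp_symm {T : Subalgebra K A} (e : T ≃ₐ[K] B) :
    (T.val.comp (e.symm : B →ₐ[K] T)).range = T := by
  ext p
  exact ⟨fun ⟨a, ha⟩ => ha ▸ (e.symm a).2, fun hp => ⟨e ⟨p, hp⟩, by simp⟩⟩

lemma injective_val_comp_symm {T : Subalgebra K A} (e : T ≃ₐ[K] B) :
    Function.Injective (T.val.comp (e.symm : B →ₐ[K] T)) :=
  Subtype.val_injective.comp e.symm.injective

lemma val_comp_symm_comp_aeval {σ : Type*} {R T : Subalgebra K A} (h : R ≤ T)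
    (e : R ≃ₐ[K] MvPolynomial σ K) (e' : T ≃ₐ[K] B) :
    (T.val.comp (e'.symm : B →ₐ[K] T)).comp
      (aeval fun i => e' (Subalgebra.inclusion h (e.symm (X i)))) =
        R.val.comp (e.symm : MvPolynomial σ K →ₐ[K] R) := by
  ext i : 1
  simp

end Subalgebra

/-- The linear substitution determines the matrix. -/
lemma eq_of_act_eq {g h : GL (Fin m) K} (hgh : ∀ p, act g p = act h p) : g = h := by
  ext i j
  have := hgh (X j)
  rw [polyAct_X, polyAct_X] at this
  rw [← coeff_sum_C_mul_X (fun i => (g : Matrix (Fin m) (Fin m) K) i j) i, this,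
    coeff_sum_C_mul_X]

/-- A non-unit of a polynomial ring lies in a prime ideal generated by one element. -/
lemma exists_isPrime_span_singleton {p : MvPolynomial (Fin m) K} (hp : ¬ IsUnit p) :
    ∃ L : MvPolynomial (Fin m) K, (Ideal.span {L}).IsPrime ∧ L ∣ p := by
  by_cases hp0 : p = 0
  · exact ⟨0, by simpa using Ideal.isPrime_bot, by rw [hp0]⟩
  · obtain ⟨L, hL, hLp⟩ := WfDvdMonoid.exists_irreducible_factor hp hp0
    exact ⟨L, (Ideal.span_singleton_prime hL.ne_zero).2 hL.prime, hLp⟩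

variable [CharZero K]

/-- A finite group is contained in any subgroup having no more invariants than it. -/
lemma le_of_polyInvariants_le {G H : Subgroup (GL (Fin m) K)} [Finite H]
    (h : polyInvariants H ≤ polyInvariants G) : G ≤ H := fun g hg => by
  obtain ⟨h', hh', heq⟩ := exists_act_sub_act_mem H ⊥ g fun t ht => by
    rw [mem_polyInvariants.1 (h ht) g hg, sub_self]
    exact zero_mem _
  rwa [eq_of_act_eq fun p => sub_eq_zero.1 (Ideal.mem_bot.1 (heq p))]

/-- A finite group whose algebra of invariants is a polynomial algebra is generated by
pseudo-reflections. -/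
theorem closure_eq_of_algEquiv (G : Subgroup (GL (Fin m) K)) [Finite G] {n : ℕ}
    (e : polyInvariants G ≃ₐ[K] MvPolynomial (Fin n) K) :
    Subgroup.closure {g : GL (Fin m) K | g ∈ G ∧
      IsPseudoReflection (g : Matrix (Fin m) (Fin m) K)} = G := by
  set S : Set (GL (Fin m) K) := {g | g ∈ G ∧ IsPseudoReflection (g : Matrix (Fin m) (Fin m) K)}
    with hS
  set H := Subgroup.closure S with hH
  have hHG : H ≤ G := (Subgroup.closure_le G).2 fun g hg => hg.1
  have : Finite H := Finite.of_injective _ (Subgroup.inclusion_injective hHG)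
  have hHclosure : Subgroup.closure {g : GL (Fin m) K | g ∈ H ∧
      IsPseudoReflection (g : Matrix (Fin m) (Fin m) K)} = H :=
    le_antisymm ((Subgroup.closure_le H).2 fun g hg => hg.1)
      (Subgroup.closure_mono fun g hg => ⟨Subgroup.subset_closure hg, hg.2⟩)
  have := Fintype.ofFinite H
  obtain ⟨k, ⟨e'⟩⟩ := exists_algEquiv_of_closure_eq H hHclosure
  obtain rfl := (eq_of_algEquiv G e).trans (eq_of_algEquiv H e').symm
  have hle : polyInvariants G ≤ polyInvariants H := fun p hp =>
    mem_polyInvariants.2 fun g hg => mem_polyInvariants.1 hp g (hHG hg)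
  set ι : MvPolynomial (Fin n) K →ₐ[K] MvPolynomial (Fin m) K :=
    (polyInvariants H).val.comp e'.symm with hι
  have hιinj : Function.Injective ι := injective_val_comp_symm e'
  have hιH : ι.range = polyInvariants H := range_val_comp_symm e'
  set f : Fin n → MvPolynomial (Fin n) K :=
    fun i => e' (Subalgebra.inclusion hle (e.symm (X i))) with hf
  have hfG : (ι.comp (aeval f)).range = polyInvariants G := by
    rw [hι, hf, val_comp_symm_comp_aeval hle e e', range_val_comp_symm]
  refine le_antisymm hHG ?_
  by_cases hdet : IsUnit (Matrix.of fun i j => pderiv j (f i)).det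
  · exact le_of_polyInvariants_le (polyInvariants_le_of_isUnit_jacobian ι hιH f hfG hdet)
  exfalso
  have hdet' : ¬ IsUnit (ι (Matrix.of fun i j => pderiv j (f i)).det) := fun h => hdet <| by
    obtain ⟨c, hc, hcι⟩ := MvPolynomial.isUnit_iff_eq_C_of_isReduced.1 h
    rw [hιinj (hcι.trans (algHom_C ι c).symm)]
    exact hc.map C
  obtain ⟨L, hLprime, hLdvd⟩ := exists_isPrime_span_singleton hdet'
  obtain ⟨g, hgG, hgH, hg⟩ := exists_act_sub_mem_of_jacobian ι hιinj hιH f hfG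
    (Ideal.Quotient.mkₐ K (Ideal.span {L}))
    (by rwa [Ideal.Quotient.mkₐ_eq_mk, Ideal.Quotient.eq_zero_iff_mem, Ideal.mem_span_singleton])
  obtain ⟨h, hhH, hgh⟩ := exists_act_sub_act_mem H (Ideal.span {L}) g fun t ht => by
    rw [← Ideal.Quotient.eq_zero_iff_mem, ← Ideal.Quotient.mkₐ_eq_mk K]
    exact hg t ht
  have hrG : h⁻¹ * g ∈ G := mul_mem (inv_mem (hHG hhH)) hgG
  have hfin : IsOfFinOrder (h⁻¹ * g) :=
    G.subtype.isOfFinOrder (isOfFinOrder_of_finite (⟨h⁻¹ * g, hrG⟩ : G))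
  have hLunit : ¬ IsUnit (act h⁻¹ L) := fun hu => hLprime.ne_top <| by
    rw [Ideal.span_singleton_eq_top, ← act_act_inv h L]
    exact hu.map (act h)
  have hrH : h⁻¹ * g ∈ H := by
    rcases eq_one_or_isPseudoReflection hfin hLunit (fun j => by
      have := map_dvd (act h⁻¹) (Ideal.mem_span_singleton.1 (hgh (X j)))
      rwa [map_sub, act_inv_act, ← act_mul_apply] at this) with h1 | h1
    · exact h1 ▸ one_mem H
    · exact Subgroup.subset_closure ⟨hrG, h1⟩
  exact hgH ((Subgroup.mul_mem_cancel_left H (inv_mem hhH)).1 hrH)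

end ShephardTodd

/-- **Shephard–Todd–Chevalley.** For a finite subgroup `G` of `GL_m(K)`, the algebra of
invariants is isomorphic to a polynomial algebra iff `G` is generated by pseudo-reflections. -/
theorem shephard_todd_chevalley {K : Type*} [Field K] [IsAlgClosed K] [CharZero K] {m : ℕ}
    (G : Subgroup (GL (Fin m) K)) [Fintype G] :
    (∃ n : ℕ, Nonempty ((polyInvariants G) ≃ₐ[K] MvPolynomial (Fin n) K)) ↔
      Subgroup.closure {g : GL (Fin m) K | g ∈ G ∧
        IsPseudoReflection (g : Matrix (Fin m) (Fin m) K)} = G :=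
  ⟨fun ⟨_, ⟨e⟩⟩ => ShephardTodd.closure_eq_of_algEquiv G e,
    ShephardTodd.exists_algEquiv_of_closure_eq G⟩
end

section
/- Let G be a finite subgroup of GL_m(K), with m ≥ 2, acting on the free associative algebra K⟨x_1,…,x_m⟩. Then the algebra of invariants K⟨x_1,…,x_m⟩^G is finitely generated as a K-algebra if and only if every element of G is a scalar matrix. -/
open Matrix

/-- The action of a matrix `g` on the free associative algebra `K⟨x_1,…,x_m⟩` by linear
substitution of the free generators: `x_j ↦ ∑ i, g i j • x_i`. -/
noncomputable def freeAct (K : Type*) [CommSemiring K] {m : ℕ}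
    (g : Matrix (Fin m) (Fin m) K) :
    FreeAlgebra K (Fin m) →ₐ[K] FreeAlgebra K (Fin m) :=
  FreeAlgebra.lift K fun j => ∑ i, g i j • FreeAlgebra.ι K i

/-- The subalgebra of invariants `K⟨x_1,…,x_m⟩^G` of a subgroup `G` of `GL_m(K)`. -/
noncomputable def freeInvariants (K : Type*) [Field K] {m : ℕ}
    (G : Subgroup (GL (Fin m) K)) : Subalgebra K (FreeAlgebra K (Fin m)) :=
  ⨅ g ∈ G, AlgHom.equalizer
    (freeAct K ((g : GL (Fin m) K) : Matrix (Fin m) (Fin m) K)) (AlgHom.id K _)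

section LinearSubstitution

variable {K : Type*} [Field K] {m : ℕ}

lemma freeAct_ι (g : Matrix (Fin m) (Fin m) K) (j : Fin m) :
    freeAct K g (FreeAlgebra.ι K j) = ∑ i, g i j • FreeAlgebra.ι K i := by
  simp [freeAct]

lemma freeAct_mul (g h : Matrix (Fin m) (Fin m) K) :
    freeAct K (g * h) = (freeAct K g).comp (freeAct K h) := by
  apply FreeAlgebra.hom_ext
  funext j
  simp only [Function.comp_apply, AlgHom.comp_apply, freeAct_ι, map_sum, map_smul,
    Finset.smul_sum, Matrix.mul_apply, Finset.sum_smul, smul_smul]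
  rw [Finset.sum_comm]
  simp only [mul_comm]

lemma freeAct_mul_apply (g h : Matrix (Fin m) (Fin m) K) (a : FreeAlgebra K (Fin m)) :
    freeAct K (g * h) a = freeAct K g (freeAct K h a) := by
  rw [freeAct_mul, AlgHom.comp_apply]

lemma mem_freeInvariants {G : Subgroup (GL (Fin m) K)} {a : FreeAlgebra K (Fin m)} :
    a ∈ freeInvariants K G ↔
      ∀ g ∈ G, freeAct K ((g : GL (Fin m) K) : Matrix (Fin m) (Fin m) K) a = a := by
  simp [freeInvariants, Algebra.mem_iInf, AlgHom.mem_equalizer]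

/-- The sum of the `G`-translates of an element. -/
noncomputable def orbitSum (G : Subgroup (GL (Fin m) K)) [Fintype G] :
    FreeAlgebra K (Fin m) →ₗ[K] FreeAlgebra K (Fin m) :=
  ∑ g : G, (freeAct K ((g : GL (Fin m) K) : Matrix (Fin m) (Fin m) K)).toLinearMap

lemma orbitSum_apply (G : Subgroup (GL (Fin m) K)) [Fintype G] (a : FreeAlgebra K (Fin m)) :
    orbitSum G a = ∑ g : G, freeAct K ((g : GL (Fin m) K) : Matrix (Fin m) (Fin m) K) a := by
  simp [orbitSum, LinearMap.sum_apply]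

lemma orbitSum_mem (G : Subgroup (GL (Fin m) K)) [Fintype G] (a : FreeAlgebra K (Fin m)) :
    orbitSum G a ∈ freeInvariants K G := by
  rw [mem_freeInvariants]
  intro h hh
  rw [orbitSum_apply, map_sum]
  refine Fintype.sum_equiv (Equiv.mulLeft (⟨h, hh⟩ : G)) _ _ fun g => ?_
  simp [freeAct_mul_apply]

lemma orbitSum_freeAct (G : Subgroup (GL (Fin m) K)) [Fintype G] {h : GL (Fin m) K}
    (hh : h ∈ G) (a : FreeAlgebra K (Fin m)) :
    orbitSum G (freeAct K (h : Matrix (Fin m) (Fin m) K) a) = orbitSum G a := by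
  simp only [orbitSum_apply]
  refine Fintype.sum_equiv (Equiv.mulRight (⟨h, hh⟩ : G)) _ _ fun g => ?_
  simp [freeAct_mul_apply]

lemma orbitSum_of_mem (G : Subgroup (GL (Fin m) K)) [Fintype G] {a : FreeAlgebra K (Fin m)}
    (ha : a ∈ freeInvariants K G) : orbitSum G a = (Fintype.card G : K) • a := by
  rw [mem_freeInvariants] at ha
  rw [orbitSum_apply, Finset.sum_congr rfl fun (g : G) _ => ha g g.2]
  simp [Nat.cast_smul_eq_nsmul]

end LinearSubstitution

section ScalarGroup

variable {K : Type*} [Field K] {m : ℕ}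

/-- The monomial attached to a list of indices. -/
def word (K : Type*) [Field K] {m : ℕ} (L : List (Fin m)) : FreeAlgebra K (Fin m) :=
  (L.map (FreeAlgebra.ι K)).prod

lemma word_append (L L' : List (Fin m)) : word K (L ++ L') = word K L * word K L' := by
  simp [word]

lemma span_range_word : Submodule.span K (Set.range (word K (m := m))) = ⊤ := by
  rw [eq_top_iff]
  suffices h : ∀ a b : FreeAlgebra K (Fin m), b ∈ Submodule.span K (Set.range (word K)) →
      a * b ∈ Submodule.span K (Set.range (word K)) by
    intro a _
    simpa using h a 1 (Submodule.subset_span ⟨[], by simp [word]⟩)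
  intro a
  induction a with
  | grade0 r =>
    intro b hb
    rw [← Algebra.smul_def]
    exact Submodule.smul_mem _ _ hb
  | grade1 x =>
    intro b hb
    induction hb using Submodule.span_induction with
    | mem b hb =>
      obtain ⟨L, rfl⟩ := hb
      exact Submodule.subset_span ⟨x :: L, by simp [word]⟩
    | zero => simp
    | add b c _ _ hb hc => rw [mul_add]; exact add_mem hb hc
    | smul r b _ hb => rw [mul_smul_comm]; exact Submodule.smul_mem _ _ hb
  | mul a a' ha ha' => intro b hb; rw [mul_assoc]; exact ha _ (ha' _ hb)
  | add a a' ha ha' => intro b hb; rw [add_mul]; exact add_mem (ha _ hb) (ha' _ hb)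

lemma freeAct_smul_one_word (c : K) (L : List (Fin m)) :
    freeAct K (c • (1 : Matrix (Fin m) (Fin m) K)) (word K L) = c ^ L.length • word K L := by
  induction L with
  | nil => simp [word]
  | cons x L ih =>
    have hx : freeAct K (c • (1 : Matrix (Fin m) (Fin m) K)) (FreeAlgebra.ι K x) =
        c • FreeAlgebra.ι K x := by
      simp [freeAct_ι, Matrix.one_apply]
    have hw : word K (x :: L) = FreeAlgebra.ι K x * word K L := by simp [word]
    rw [hw, map_mul, ih, hx, smul_mul_smul_comm, List.length_cons, pow_succ']

lemma word_ne_zero (L : List (Fin m)) : word K L ≠ 0 := by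
  refine List.prod_ne_zero ?_
  simp [FreeAlgebra.ι_ne_zero]

lemma word_mem_freeInvariants_iff {G : Subgroup (GL (Fin m) K)} {s : G → K}
    (hs : ∀ g : G, ((g : GL (Fin m) K) : Matrix (Fin m) (Fin m) K) =
      s g • (1 : Matrix (Fin m) (Fin m) K)) (L : List (Fin m)) :
    word K L ∈ freeInvariants K G ↔ ∀ g, s g ^ L.length = 1 := by
  rw [mem_freeInvariants]
  constructor
  · intro h g
    have := h g g.2
    rw [hs, freeAct_smul_one_word] at this
    exact smul_left_injective K (word_ne_zero L) (by simpa using this)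
  · intro h g hg
    rw [hs ⟨g, hg⟩, freeAct_smul_one_word, h, one_smul]

theorem freeInvariants_fg_of_scalar [CharZero K] (hm : 0 < m) (G : Subgroup (GL (Fin m) K))
    [Fintype G] (hG : ∀ g : GL (Fin m) K, g ∈ G → ∃ c : K,
      (g : Matrix (Fin m) (Fin m) K) = c • (1 : Matrix (Fin m) (Fin m) K)) :
    (freeInvariants K G).FG := by
  choose! s' hs' using hG
  obtain ⟨s, hs⟩ : ∃ s : G → K, ∀ g : G, ((g : GL (Fin m) K) : Matrix (Fin m) (Fin m) K) =
      s g • (1 : Matrix (Fin m) (Fin m) K) := ⟨fun g => s' g, fun g => hs' g g.2⟩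
  set N := Fintype.card G with hN
  have hpow : ∀ g, s g ^ N = 1 := by
    intro g
    have h1 : ((g : GL (Fin m) K) : Matrix (Fin m) (Fin m) K) ^ N = 1 := by
      have : g ^ N = 1 := pow_card_eq_one
      have h2 := congrArg (fun g : G => ((g : GL (Fin m) K) : Matrix (Fin m) (Fin m) K)) this
      simpa using h2
    rw [hs, smul_pow, one_pow] at h1
    simpa using congrFun (congrFun h1 ⟨0, hm⟩) ⟨0, hm⟩
  set S : Set (FreeAlgebra K (Fin m)) :=
    word K '' {L | L.length ≤ N ∧ word K L ∈ freeInvariants K G} with hS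
  have hSfin : S.Finite :=
    ((List.finite_length_le (Fin m) N).subset fun L hL => hL.1).image _
  have hword : ∀ n, ∀ L : List (Fin m), L.length ≤ n → word K L ∈ freeInvariants K G →
      word K L ∈ Algebra.adjoin K S := by
    intro n
    induction n with
    | zero =>
      intro L hL hinv
      exact Algebra.subset_adjoin ⟨L, ⟨by omega, hinv⟩, rfl⟩
    | succ n ih =>
      intro L hL hinv
      have hNpos : 0 < N := Fintype.card_pos
      by_cases hLN : L.length ≤ N
      · exact Algebra.subset_adjoin ⟨L, ⟨hLN, hinv⟩, rfl⟩
      have hlen : L.length = (L.take N).length + (L.drop N).length := by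
        simp; omega
      have htake : (L.take N).length = N := by simp; omega
      rw [word_mem_freeInvariants_iff hs] at hinv
      rw [← List.take_append_drop N L, word_append]
      refine mul_mem (Algebra.subset_adjoin ⟨_, ⟨htake.le, ?_⟩, rfl⟩) (ih _ (by omega) ?_)
      · rw [word_mem_freeInvariants_iff hs, htake]
        exact hpow
      · rw [word_mem_freeInvariants_iff hs]
        intro g
        have := hinv g
        rwa [hlen, pow_add, htake, hpow, one_mul] at this
  have hsum : ∀ a, orbitSum G a ∈ Algebra.adjoin K S := by
    intro a
    have ha : a ∈ Submodule.span K (Set.range (word K (m := m))) := by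
      rw [span_range_word]; trivial
    induction ha using Submodule.span_induction with
    | mem b hb =>
      obtain ⟨L, rfl⟩ := hb
      by_cases hL : word K L ∈ freeInvariants K G
      · rw [orbitSum_of_mem G hL]
        exact Subalgebra.smul_mem _ (hword _ L le_rfl hL) _
      · have hL' := hL
        rw [word_mem_freeInvariants_iff hs] at hL'
        push Not at hL'
        obtain ⟨g, hg⟩ := hL'
        have h := orbitSum_freeAct G g.2 (word K L)
        rw [hs, freeAct_smul_one_word, map_smul] at h
        have h0 : (s g ^ L.length - 1) • orbitSum G (word K L) = 0 := by
          rw [sub_smul, h, one_smul, sub_self]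
        rw [(smul_eq_zero.1 h0).resolve_left (sub_ne_zero.2 hg)]
        exact zero_mem _
    | zero => simp
    | add b c _ _ hb hc => rw [map_add]; exact add_mem hb hc
    | smul r b _ hb => rw [map_smul]; exact Subalgebra.smul_mem _ hb _
  rw [Subalgebra.fg_def]
  refine ⟨S, hSfin, le_antisymm (Algebra.adjoin_le ?_) fun a ha => ?_⟩
  · rintro _ ⟨L, hL, rfl⟩
    exact hL.2
  · have h := hsum a
    rw [orbitSum_of_mem G ha] at h
    have hN0 : (Fintype.card G : K) ≠ 0 := Nat.cast_ne_zero.2 Fintype.card_ne_zero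
    simpa [smul_smul, inv_mul_cancel₀ hN0] using
      Subalgebra.smul_mem _ h (Fintype.card G : K)⁻¹

end ScalarGroup

section FoxDerivative

variable {K : Type*} [Field K] {m : ℕ}

/-- The algebra homomorphism `a ↦ !![ε a, ∂ a; 0, a]` which encodes the Fox derivative `∂`
along a linear form `φ`, with `ε` the augmentation. -/
noncomputable def foxMatrix (φ : Fin m → K) :
    FreeAlgebra K (Fin m) →ₐ[K] Matrix (Fin 2) (Fin 2) (FreeAlgebra K (Fin m)) :=
  FreeAlgebra.lift K fun j =>
    !![0, algebraMap K (FreeAlgebra K (Fin m)) (φ j); 0, FreeAlgebra.ι K j]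

/-- The Fox derivative along a linear form `φ`: it kills constants and sends the monomial
`x_j w` to `φ j • w`. -/
noncomputable def foxDeriv (φ : Fin m → K) :
    FreeAlgebra K (Fin m) →ₗ[K] FreeAlgebra K (Fin m) where
  toFun a := foxMatrix φ a 0 1
  map_add' a b := by simp
  map_smul' r a := by simp

/-- The augmentation, sending every free generator to `0`. -/
noncomputable def augmentation (K : Type*) [Field K] (m : ℕ) : FreeAlgebra K (Fin m) →ₐ[K] K :=
  FreeAlgebra.lift K fun _ => 0

lemma augmentation_ι (j : Fin m) : augmentation K m (FreeAlgebra.ι K j) = 0 := by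
  simp [augmentation]

lemma augmentation_freeAct (g : Matrix (Fin m) (Fin m) K) (a : FreeAlgebra K (Fin m)) :
    augmentation K m (freeAct K g a) = augmentation K m a := by
  suffices h : (augmentation K m).comp (freeAct K g) = augmentation K m from
    DFunLike.congr_fun h a
  apply FreeAlgebra.hom_ext
  funext j
  simp [freeAct_ι, augmentation_ι]

lemma foxMatrix_apply (φ : Fin m → K) (a : FreeAlgebra K (Fin m)) :
    foxMatrix φ a =
      !![algebraMap K _ (augmentation K m a), foxDeriv φ a; 0, a] := by
  suffices h : foxMatrix φ a 0 0 = algebraMap K _ (augmentation K m a) ∧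
      foxMatrix φ a 1 0 = 0 ∧ foxMatrix φ a 1 1 = a by
    ext i j
    fin_cases i <;> fin_cases j <;> simp [h, foxDeriv]
  induction a with
  | grade0 r => simp [Matrix.algebraMap_matrix_apply]
  | grade1 x => simp [foxMatrix, augmentation_ι]
  | mul a b ha hb => simp [Matrix.mul_apply, ha, hb]
  | add a b ha hb => simp [ha, hb]

lemma foxDeriv_mul (φ : Fin m → K) (a b : FreeAlgebra K (Fin m)) :
    foxDeriv φ (a * b) = foxDeriv φ a * b + augmentation K m a • foxDeriv φ b := by
  have h := congrFun (congrFun (map_mul (foxMatrix φ) a b) 0) 1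
  simp only [foxMatrix_apply] at h
  simpa [Matrix.mul_apply, Algebra.smul_def, add_comm] using h

lemma foxDeriv_algebraMap (φ : Fin m → K) (r : K) :
    foxDeriv φ (algebraMap K _ r) = 0 := by
  simp [foxDeriv, Matrix.algebraMap_matrix_apply]

lemma foxDeriv_ι (φ : Fin m → K) (j : Fin m) :
    foxDeriv φ (FreeAlgebra.ι K j) = algebraMap K _ (φ j) := by
  simp [foxDeriv, foxMatrix]

lemma foxDeriv_ι_mul (φ : Fin m → K) (j : Fin m) (a : FreeAlgebra K (Fin m)) :
    foxDeriv φ (FreeAlgebra.ι K j * a) = φ j • a := by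
  simp [foxDeriv_mul, foxDeriv_ι, augmentation_ι, Algebra.smul_def]

lemma foxDeriv_freeAct_ι_mul (φ : Fin m → K) (g : Matrix (Fin m) (Fin m) K) (j : Fin m)
    (a : FreeAlgebra K (Fin m)) :
    foxDeriv φ (freeAct K g (FreeAlgebra.ι K j) * a) = (φ ᵥ* g) j • a := by
  simp [freeAct_ι, Finset.sum_mul, foxDeriv_ι_mul, Matrix.vecMul, dotProduct,
    Finset.sum_smul, smul_smul, mul_comm]

lemma foxDeriv_freeAct (φ : Fin m → K) (g : Matrix (Fin m) (Fin m) K)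
    (a : FreeAlgebra K (Fin m)) :
    foxDeriv φ (freeAct K g a) = freeAct K g (foxDeriv (φ ᵥ* g) a) := by
  induction a with
  | grade0 r => simp [foxDeriv_algebraMap]
  | grade1 x =>
    have h := foxDeriv_freeAct_ι_mul φ g x 1
    rw [mul_one] at h
    rw [h, foxDeriv_ι, AlgHom.commutes, Algebra.algebraMap_eq_smul_one]
  | mul a b ha hb => simp [foxDeriv_mul, ha, hb, augmentation_freeAct]
  | add a b ha hb => simp [ha, hb]

/-- The iterated Fox derivative along a list of linear forms, the head being applied first. -/
noncomputable def iterFox :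
    List (Fin m → K) → FreeAlgebra K (Fin m) →ₗ[K] FreeAlgebra K (Fin m)
  | [] => LinearMap.id
  | φ :: L => iterFox L ∘ₗ foxDeriv φ

lemma iterFox_nil (a : FreeAlgebra K (Fin m)) : iterFox [] a = a := rfl

lemma iterFox_cons (φ : Fin m → K) (L : List (Fin m → K)) (a : FreeAlgebra K (Fin m)) :
    iterFox (φ :: L) a = iterFox L (foxDeriv φ a) := rfl

lemma iterFox_eventually_zero (a : FreeAlgebra K (Fin m)) :
    ∃ d, ∀ L : List (Fin m → K), d ≤ L.length → iterFox L a = 0 := by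
  suffices h : ∀ a b : FreeAlgebra K (Fin m),
      (∃ d, ∀ L : List (Fin m → K), d ≤ L.length → iterFox L b = 0) →
      ∃ d, ∀ L : List (Fin m → K), d ≤ L.length → iterFox L (a * b) = 0 by
    refine mul_one a ▸ h a 1 ⟨1, fun L hL => ?_⟩
    cases L with
    | nil => simp at hL
    | cons φ L =>
      rw [iterFox_cons, ← map_one (algebraMap K _), foxDeriv_algebraMap, map_zero]
  intro a
  induction a with
  | grade0 r =>
    rintro b ⟨d, hd⟩
    exact ⟨d, fun L hL => by rw [← Algebra.smul_def, map_smul, hd L hL, smul_zero]⟩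
  | grade1 x =>
    rintro b ⟨d, hd⟩
    refine ⟨d + 1, fun L hL => ?_⟩
    cases L with
    | nil => simp at hL
    | cons φ L =>
      rw [iterFox_cons, foxDeriv_ι_mul, map_smul, hd L (by simpa using hL), smul_zero]
  | mul a a' ha ha' => intro b hb; simpa only [mul_assoc] using ha _ (ha' _ hb)
  | add a a' ha ha' =>
    intro b hb
    obtain ⟨d, hd⟩ := ha b hb
    obtain ⟨d', hd'⟩ := ha' b hb
    exact ⟨max d d', fun L hL => by
      rw [add_mul, map_add, hd L (le_trans (le_max_left _ _) hL),
        hd' L (le_trans (le_max_right _ _) hL), add_zero]⟩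

lemma exists_iterFox_freeAct_mul (L : List (Fin m → K)) (hL : ∀ φ ∈ L, φ ≠ 0) :
    ∃ (y : FreeAlgebra K (Fin m)) (c : Matrix (Fin m) (Fin m) K → K), c 1 ≠ 0 ∧
      ∀ g z, iterFox L (freeAct K g (y * z)) = c g • freeAct K g z := by
  induction L with
  | nil => exact ⟨1, fun _ => 1, one_ne_zero, fun g z => by simp [iterFox_nil]⟩
  | cons φ L ih =>
    obtain ⟨y, c, hc, h⟩ := ih fun ψ hψ => hL ψ (List.mem_cons_of_mem _ hψ)
    obtain ⟨j, hj⟩ := Function.ne_iff.1 (hL φ List.mem_cons_self)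
    refine ⟨FreeAlgebra.ι K j * y, fun g => (φ ᵥ* g) j * c g, ?_, fun g z => ?_⟩
    · simpa using ⟨hj, hc⟩
    · rw [iterFox_cons, mul_assoc, map_mul, foxDeriv_freeAct_ι_mul, map_smul, h, smul_smul]

end FoxDerivative

section NonscalarGroup

variable {K : Type*} [Field K] {m : ℕ}

lemma foxDeriv_eigen {g : Matrix (Fin m) (Fin m) K} {φ : Fin m → K} {r μ : K}
    (hφ : φ ᵥ* g = r • φ) {a : FreeAlgebra K (Fin m)} (ha : a = μ • freeAct K g a) :
    foxDeriv φ a = (μ * r) • freeAct K g (foxDeriv φ a) := by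
  have hsmul : foxDeriv (r • φ) a = r • foxDeriv φ a := by
    clear ha
    induction a with
    | grade0 s => simp [foxDeriv_algebraMap]
    | grade1 x => simp [foxDeriv_ι, Algebra.smul_def]
    | mul a b ha hb => simp [foxDeriv_mul, ha, hb, smul_comm r]
    | add a b ha hb => simp [ha, hb]
  conv_lhs => rw [ha]
  rw [map_smul, foxDeriv_freeAct, hφ, hsmul, map_smul, smul_smul]

lemma augmentation_eq_zero_of_eigen {g : Matrix (Fin m) (Fin m) K} {μ : K} (hμ : μ ≠ 1)
    {a : FreeAlgebra K (Fin m)} (ha : a = μ • freeAct K g a) : augmentation K m a = 0 := by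
  have h := congrArg (augmentation K m) ha
  rw [map_smul, augmentation_freeAct, smul_eq_mul] at h
  have h' : (1 - μ) * augmentation K m a = 0 := by linear_combination h
  exact (mul_eq_zero.1 h').resolve_left (sub_ne_zero.2 hμ.symm)

lemma exists_mem_pair_mul_ne_one {r₁ r₂ : K} (hr : r₁ ≠ r₂) {g : Matrix (Fin m) (Fin m) K}
    {φ₁ φ₂ : Fin m → K} (h₁ : φ₁ ᵥ* g = r₁ • φ₁) (h₂ : φ₂ ᵥ* g = r₂ • φ₂) (μ : K) :
    ∃ φ r, (φ = φ₁ ∨ φ = φ₂) ∧ φ ᵥ* g = r • φ ∧ μ * r ≠ 1 := by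
  by_cases h : μ * r₁ = 1
  · refine ⟨φ₂, r₂, Or.inr rfl, h₂, fun h' => hr ?_⟩
    exact mul_left_cancel₀ (left_ne_zero_of_mul_eq_one h) (h.trans h'.symm)
  · exact ⟨φ₁, r₁, Or.inl rfl, h₁, h⟩

lemma exists_iterFox_mul_of_ne_one {r₁ r₂ : K} (hr : r₁ ≠ r₂)
    {g : Matrix (Fin m) (Fin m) K} {φ₁ φ₂ : Fin m → K} (h₁ : φ₁ ᵥ* g = r₁ • φ₁)
    (h₂ : φ₂ ᵥ* g = r₂ • φ₂) (n : ℕ) (μ : K) (hμ : μ ≠ 1) :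
    ∃ L : List (Fin m → K), L.length = n ∧ (∀ φ ∈ L, φ = φ₁ ∨ φ = φ₂) ∧
      ∀ a b, a = μ • freeAct K g a → iterFox L (a * b) = iterFox L a * b := by
  induction n generalizing μ with
  | zero => exact ⟨[], rfl, by simp, fun a b _ => rfl⟩
  | succ n ih =>
    obtain ⟨φ, r, hφ, hφr, hne⟩ := exists_mem_pair_mul_ne_one hr h₁ h₂ μ
    obtain ⟨L, hlen, hL, hmul⟩ := ih _ hne
    refine ⟨φ :: L, by simp [hlen], by simpa [hφ] using hL, fun a b ha => ?_⟩
    rw [iterFox_cons, foxDeriv_mul, augmentation_eq_zero_of_eigen hμ ha, zero_smul, add_zero,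
      hmul _ _ (foxDeriv_eigen hφr ha), iterFox_cons]

lemma exists_iterFox_mul_of_invariant {r₁ r₂ : K} (hr : r₁ ≠ r₂)
    {g : Matrix (Fin m) (Fin m) K} {φ₁ φ₂ : Fin m → K} (h₁ : φ₁ ᵥ* g = r₁ • φ₁)
    (h₂ : φ₂ ᵥ* g = r₂ • φ₂) (n : ℕ) :
    ∃ L : List (Fin m → K), L.length = n + 1 ∧ (∀ φ ∈ L, φ = φ₁ ∨ φ = φ₂) ∧
      ∀ a b, freeAct K g a = a →
        iterFox L (a * b) = iterFox L a * b + augmentation K m a • iterFox L b := by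
  obtain ⟨φ, r, hφ, hφr, hne⟩ := exists_mem_pair_mul_ne_one hr h₁ h₂ 1
  obtain ⟨L, hlen, hL, hmul⟩ := exists_iterFox_mul_of_ne_one hr h₁ h₂ n _ hne
  refine ⟨φ :: L, by simp [hlen], by simpa [hφ] using hL, fun a b ha => ?_⟩
  have ha' : a = (1 : K) • freeAct K g a := by rw [ha, one_smul]
  rw [iterFox_cons, foxDeriv_mul, map_add, hmul _ _ (foxDeriv_eigen hφr ha'), map_smul,
    iterFox_cons, iterFox_cons]

/-- Dedekind independence of the substitutions by distinct matrices. -/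
lemma eq_zero_of_sum_smul_freeAct_eq_zero {ι : Type*} [Fintype ι]
    {A : ι → Matrix (Fin m) (Fin m) K} (hA : Function.Injective A) {c : ι → K}
    (h : ∀ z, ∑ i, c i • freeAct K (A i) z = 0) (i : ι) : c i = 0 := by
  let π : FreeAlgebra K (Fin m) →ₐ[K] MvPolynomial (Fin m) K :=
    FreeAlgebra.lift K MvPolynomial.X
  let χ : ι → FreeAlgebra K (Fin m) →* MvPolynomial (Fin m) K := fun i =>
    ((π.comp (freeAct K (A i)) : _ →ₐ[K] _) : _ →* _)
  have hχ : ∀ i z, χ i z = π (freeAct K (A i) z) := fun _ _ => rfl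
  have hinj : Function.Injective χ := by
    intro i j hij
    apply hA
    ext k l
    have := congrArg (MvPolynomial.coeff (Finsupp.single k 1))
      (DFunLike.congr_fun hij (FreeAlgebra.ι K l))
    simpa [hχ, freeAct_ι, π, MvPolynomial.coeff_sum, MvPolynomial.coeff_smul,
      MvPolynomial.coeff_X, Finsupp.single_left_inj] using this
  have hli := (linearIndependent_monoidHom (FreeAlgebra K (Fin m))
    (MvPolynomial (Fin m) K)).comp χ hinj
  have := Fintype.linearIndependent_iff.1 hli (fun i => MvPolynomial.C (c i)) (by
    funext z
    have hz := congrArg π (h z)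
    simpa [hχ, Finset.sum_apply, MvPolynomial.smul_eq_C_mul] using hz) i
  simpa using this

lemma exists_left_eigenvectors [IsAlgClosed K] [CharZero K] (hm : 0 < m)
    {g : Matrix (Fin m) (Fin m) K} {N : ℕ} (hN : 0 < N) (hgN : g ^ N = 1)
    (hg : ¬ ∃ c : K, g = c • (1 : Matrix (Fin m) (Fin m) K)) :
    ∃ (r₁ r₂ : K) (φ₁ φ₂ : Fin m → K), r₁ ≠ r₂ ∧ φ₁ ≠ 0 ∧ φ₂ ≠ 0 ∧
      φ₁ ᵥ* g = r₁ • φ₁ ∧ φ₂ ᵥ* g = r₂ • φ₂ := by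
  have : NeZero m := ⟨hm.ne'⟩
  let f : Module.End K (Fin m → K) := Matrix.toLin' gᵀ
  have hf : ∀ φ, f φ = φ ᵥ* g := fun φ => by
    simp [f, Matrix.toLin'_apply, Matrix.mulVec_transpose]
  have hfN : f ^ N = 1 := by
    rw [← Matrix.toLin'_pow, ← Matrix.transpose_pow, hgN, Matrix.transpose_one,
      Matrix.toLin'_one]
    rfl
  have hsep : (minpoly K f).Separable := by
    refine (Polynomial.separable_X_pow_sub_C (1 : K) (n := N) (by simpa using hN.ne')
      one_ne_zero).of_dvd (minpoly.dvd K f ?_)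
    simp [hfN]
  have hmonic : (minpoly K f).Monic := minpoly.monic (Algebra.IsIntegral.isIntegral f)
  obtain ⟨r, hr⟩ := Module.End.exists_eigenvalue f
  by_cases hall : ∀ s, f.HasEigenvalue s → s = r
  · exfalso
    have hroots : (minpoly K f).roots = {r} := by
      have hnd := Polynomial.nodup_roots hsep
      refine (Multiset.Nodup.ext hnd (Multiset.nodup_singleton r)).2 fun s => ?_
      rw [Polynomial.mem_roots hmonic.ne_zero, Multiset.mem_singleton,
        ← Module.End.hasEigenvalue_iff_isRoot]
      exact ⟨hall s, fun h => h ▸ hr⟩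
    have hmin := (IsAlgClosed.splits (minpoly K f)).eq_prod_roots_of_monic hmonic
    rw [hroots] at hmin
    have h0 := minpoly.aeval K f
    rw [hmin] at h0
    have hfr : f = r • LinearMap.id := by
      have h1 : f - algebraMap K _ r = 0 := by simpa using h0
      rw [sub_eq_zero.1 h1, Algebra.algebraMap_eq_smul_one]
      rfl
    refine hg ⟨r, ?_⟩
    have h2 : gᵀ = r • 1 := by
      apply Matrix.toLin'.injective
      rw [map_smul, Matrix.toLin'_one]
      exact hfr
    simpa using congrArg Matrix.transpose h2
  · push Not at hall
    obtain ⟨s, hs, hne⟩ := hall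
    obtain ⟨φ, hφ⟩ := hr.exists_hasEigenvector
    obtain ⟨ψ, hψ⟩ := hs.exists_hasEigenvector
    exact ⟨s, r, ψ, φ, hne, hψ.2, hφ.2, by rw [← hf, hψ.apply_eq_smul],
      by rw [← hf, hφ.apply_eq_smul]⟩

theorem scalar_of_freeInvariants_fg [IsAlgClosed K] [CharZero K] (hm : 0 < m)
    (G : Subgroup (GL (Fin m) K)) [Fintype G] (hfg : (freeInvariants K G).FG)
    (g : GL (Fin m) K) (hg : g ∈ G) :
    ∃ c : K, (g : Matrix (Fin m) (Fin m) K) = c • (1 : Matrix (Fin m) (Fin m) K) := by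
  by_contra hns
  have hgN : (g : Matrix (Fin m) (Fin m) K) ^ Fintype.card G = 1 := by
    have h : (⟨g, hg⟩ : G) ^ Fintype.card G = 1 := pow_card_eq_one
    have h' : g ^ Fintype.card G = 1 := congrArg Subtype.val h
    rw [← Units.val_pow_eq_pow_val, h', Units.val_one]
  obtain ⟨r₁, r₂, φ₁, φ₂, hr, hφ₁, hφ₂, h₁, h₂⟩ :=
    exists_left_eigenvectors hm Fintype.card_pos hgN hns
  obtain ⟨S, hS⟩ := hfg
  choose d hd using iterFox_eventually_zero (K := K) (m := m)
  obtain ⟨L, hlen, hL, hmul⟩ := exists_iterFox_mul_of_invariant hr h₁ h₂ (S.sup d)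
  have hkill : ∀ a ∈ freeInvariants K G, iterFox L a = 0 := by
    intro a ha
    rw [← hS] at ha
    induction ha using Algebra.adjoin_induction with
    | mem a ha => exact hd a L (by rw [hlen]; exact (Finset.le_sup ha).trans (Nat.le_succ _))
    | algebraMap r =>
      cases L with
      | nil => simp at hlen
      | cons φ L => rw [iterFox_cons, foxDeriv_algebraMap, map_zero]
    | add a b _ _ ha hb => rw [map_add, ha, hb, add_zero]
    | mul a b hma _ ha hb =>
      rw [hS, mem_freeInvariants] at hma
      rw [hmul a b (hma g hg), ha, hb, zero_mul, smul_zero, add_zero]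
  obtain ⟨y, c, hc, hy⟩ := exists_iterFox_freeAct_mul L fun φ hφ => by
    rcases hL φ hφ with rfl | rfl <;> assumption
  have hinj : Function.Injective
      fun g : G => ((g : GL (Fin m) K) : Matrix (Fin m) (Fin m) K) :=
    Units.val_injective.comp Subtype.val_injective
  refine hc ?_
  have h0 := eq_zero_of_sum_smul_freeAct_eq_zero hinj
    (c := fun g => c ((g : GL (Fin m) K) : Matrix (Fin m) (Fin m) K)) (fun z => ?_) 1
  · simpa using h0
  · have h := hkill _ (orbitSum_mem G (y * z))
    rw [orbitSum_apply, map_sum] at h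
    simpa only [hy] using h

end NonscalarGroup

/-- **Dicks–Formanek, Kharchenko.** For a finite subgroup `G ≤ GL_m(K)` (`m ≥ 2`), the algebra
of invariants `K⟨x_1,…,x_m⟩^G` is a finitely generated `K`-algebra iff every element of `G`
is a scalar matrix. -/
theorem freeInvariants_fg_iff_scalar {K : Type*} [Field K] [IsAlgClosed K] [CharZero K]
    {m : ℕ} (hm : 2 ≤ m) (G : Subgroup (GL (Fin m) K)) [Fintype G] :
    (freeInvariants K G).FG ↔
      ∀ g : GL (Fin m) K, g ∈ G → ∃ c : K,
        (g : Matrix (Fin m) (Fin m) K) = c • (1 : Matrix (Fin m) (Fin m) K) :=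
  ⟨scalar_of_freeInvariants_fg (by omega) G, freeInvariants_fg_of_scalar (by omega) G⟩
end
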